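/- arXiv:2302.05824 — 2 statements merged into one kernel-verified Lean document; each statement's English description precedes it below -/
import Mathlib

section
/- Let α,β>-1 and let f be a generalized Φ-function (type I) with parameters a∈(-1,1), λ>0 and smooth z with z(a)≠0. Then there exist constants C>0 and N such that for all integers n≥N and all x∈[-1,1], |a_n^{(α,β)}(x;g)| ≤ C n^{-λ+1/2}, with C independent of x. -/
open MeasureTheory Set

/-- Jacobi polynomial via Rodrigues' formula. -/
noncomputable def jacobiP (a b : ℝ) (n : ℕ) (x : ℝ) : ℝ :=
  ((-1 : ℝ) ^ n / (2 ^ n * (n.factorial : ℝ))) * (1 - x) ^ (-a) * (1 + x) ^ (-b) *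
    iteratedDeriv n (fun y => (1 - y) ^ ((n : ℝ) + a) * (1 + y) ^ ((n : ℝ) + b)) x

/-- Jacobi weight. -/
noncomputable def jacobiWeight (a b : ℝ) (x : ℝ) : ℝ := (1 - x) ^ a * (1 + x) ^ b

/-- Normalization constant σ_n^{(α,β)}. -/
noncomputable def jacobiSigma (a b : ℝ) (n : ℕ) : ℝ :=
  2 ^ (a + b + 1) * Real.Gamma ((n : ℝ) + a + 1) * Real.Gamma ((n : ℝ) + b + 1) /
    ((n.factorial : ℝ) * (2 * (n : ℝ) + a + b + 1) * Real.Gamma ((n : ℝ) + a + b + 1))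

/-- Jacobi expansion coefficient of `f`. -/
noncomputable def jacobiCoeff (a b : ℝ) (n : ℕ) (f : ℝ → ℝ) : ℝ :=
  (1 / jacobiSigma a b n) * ∫ x in (-1 : ℝ)..1, f x * jacobiP a b n x * jacobiWeight a b x

/-- Truncated Jacobi expansion S_n^{(α,β)}[f]. -/
noncomputable def jacobiTrunc (a b : ℝ) (n : ℕ) (f : ℝ → ℝ) (x : ℝ) : ℝ :=
  ∑ k ∈ Finset.range (n + 1), jacobiCoeff a b k f * jacobiP a b k x

/-- Pointwise error e_f^{(α,β)}(n,x). -/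
noncomputable def jacobiErr (a b : ℝ) (n : ℕ) (f : ℝ → ℝ) (x : ℝ) : ℝ :=
  |f x - jacobiTrunc a b n f x|

/-- Jacobi coefficient a_n^{(α,β)}(x;g) of the difference quotient g(x,y)=(f(x)-f(y))/(x-y). -/
noncomputable def jacobiCoeffG (a b : ℝ) (n : ℕ) (f : ℝ → ℝ) (x : ℝ) : ℝ :=
  jacobiCoeff a b n (fun y => (f x - f y) / (x - y))

/-- Generalized Φ-function of type I. -/
noncomputable def phiFunI (c lam : ℝ) (z : ℝ → ℝ) (x : ℝ) : ℝ :=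
  if x < c then 0
  else if x = c then (if lam = 0 then z c / 2 else 0)
  else z x * (x - c) ^ lam

/-- Generalized Φ-function of type II. -/
noncomputable def phiFunII (c lam : ℝ) (z : ℝ → ℝ) (x : ℝ) : ℝ := |x - c| ^ lam * z x

/-- `lam` is an even integer. -/
def IsEvenInt (lam : ℝ) : Prop := ∃ k : ℤ, lam = 2 * (k : ℝ)


open MeasureTheory Set

/-- Jacobi polynomials as genuine polynomials, defined by a parameter-shifting recursion. -/
noncomputable def jacPoly : ℕ → ℝ → ℝ → Polynomial ℝ
  | 0, _, _ => 1
  | n + 1, a, b =>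
      Polynomial.C (-1 / (2 * ((n : ℝ) + 1))) *
        ((Polynomial.C (b - a) - Polynomial.C (a + b + 2) * Polynomial.X) *
            jacPoly n (a + 1) (b + 1) +
          (1 - Polynomial.X ^ 2) * Polynomial.derivative (jacPoly n (a + 1) (b + 1)))

/-- Evaluation of the Jacobi polynomial. -/
noncomputable def jac (n : ℕ) (a b x : ℝ) : ℝ := (jacPoly n a b).eval x

/-- Evaluation of the derivative of the Jacobi polynomial. -/
noncomputable def jacD (n : ℕ) (a b x : ℝ) : ℝ := (Polynomial.derivative (jacPoly n a b)).eval x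

lemma jac_hasDerivAt (n : ℕ) (a b x : ℝ) : HasDerivAt (jac n a b) (jacD n a b x) x :=
  (jacPoly n a b).hasDerivAt x

lemma jac_continuous (n : ℕ) (a b : ℝ) : Continuous (jac n a b) :=
  (jacPoly n a b).continuous

lemma jacD_continuous (n : ℕ) (a b : ℝ) : Continuous (jacD n a b) :=
  (Polynomial.derivative (jacPoly n a b)).continuous

lemma jac_zero (a b x : ℝ) : jac 0 a b x = 1 := by simp [jac, jacPoly]

lemma jac_succ (n : ℕ) (a b x : ℝ) :
    -2 * ((n : ℝ) + 1) * jac (n + 1) a b x =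
      ((b - a) - (a + b + 2) * x) * jac n (a + 1) (b + 1) x
        + (1 - x ^ 2) * jacD n (a + 1) (b + 1) x := by
  have : (n : ℝ) + 1 ≠ 0 := by positivity
  simp only [jac, jacD, jacPoly]
  simp
  field_simp

lemma jac_step (n : ℕ) (a b x : ℝ)
    (hode : ∀ x, ((b + 1) - (a + 1) - ((a + 1) + (b + 1) + 2) * x) * jacD n (a + 1) (b + 1) x +
        (1 - x ^ 2) * (Polynomial.derivative
          (Polynomial.derivative (jacPoly n (a + 1) (b + 1)))).eval x
        = -((n : ℝ) * (n + (a + 1) + (b + 1) + 1)) * jac n (a + 1) (b + 1) x) :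
    jacD (n + 1) a b x = ((n : ℝ) + a + b + 2) / 2 * jac n (a + 1) (b + 1) x := by
  have h0 : (n : ℝ) + 1 ≠ 0 := by positivity
  have h1 : -2 * ((n : ℝ) + 1) * jacD (n + 1) a b x =
      -(a + b + 2) * jac n (a + 1) (b + 1) x
      + ((b - a) - (a + b + 2) * x) * jacD n (a + 1) (b + 1) x
      + (-2 * x) * jacD n (a + 1) (b + 1) x + (1 - x ^ 2) * (Polynomial.derivative
          (Polynomial.derivative (jacPoly n (a + 1) (b + 1)))).eval x := by
    simp only [jac, jacD, jacPoly]
    simp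
    field_simp
    ring
  have h2 := hode x
  have h3 : ((n : ℝ) + 1) * jacD (n + 1) a b x =
      ((n : ℝ) + 1) * (((n : ℝ) + a + b + 2) / 2 * jac n (a + 1) (b + 1) x) := by
    linear_combination (-1 / 2) * h1 + (-1 / 2) * h2
  exact mul_left_cancel₀ h0 h3

lemma jac_ode (n : ℕ) : ∀ a b x : ℝ, (b - a - (a + b + 2) * x) * jacD n a b x +
        (1 - x ^ 2) * (Polynomial.derivative
          (Polynomial.derivative (jacPoly n a b))).eval x
        = -((n : ℝ) * (n + a + b + 1)) * jac n a b x := by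
  induction n with
  | zero => intro a b x; simp [jac, jacD, jacPoly]
  | succ n ih =>
    intro a b x
    have hs : Polynomial.derivative (jacPoly (n + 1) a b) =
        Polynomial.C (((n : ℝ) + a + b + 2) / 2) * jacPoly n (a + 1) (b + 1) := by
      apply Polynomial.funext
      intro y
      have := jac_step n a b y (ih (a + 1) (b + 1))
      simp only [jac, jacD] at this
      rw [this]; simp
    have h1 := jac_succ n a b x
    have h2 : (Polynomial.derivative (Polynomial.derivative (jacPoly (n + 1) a b))).eval x =
        (((n : ℝ) + a + b + 2) / 2) * jacD n (a + 1) (b + 1) x := by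
      rw [hs]; simp [jacD]
    rw [h2, jac_step n a b x (ih (a + 1) (b + 1))]
    push_cast
    linear_combination -((n : ℝ) + a + b + 2) / 2 * h1

lemma jacD_succ (n : ℕ) (a b x : ℝ) :
    jacD (n + 1) a b x = ((n : ℝ) + a + b + 2) / 2 * jac n (a + 1) (b + 1) x :=
  jac_step n a b x (jac_ode n (a + 1) (b + 1))

lemma jacD_hasDerivAt (n : ℕ) (a b x : ℝ) : HasDerivAt (jacD n a b)
    ((Polynomial.derivative (Polynomial.derivative (jacPoly n a b))).eval x) x :=
  (Polynomial.derivative (jacPoly n a b)).hasDerivAt x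

lemma jacobiWeight_hasDerivAt (a b : ℝ) {x : ℝ} (hx : x ∈ Ioo (-1 : ℝ) 1) :
    HasDerivAt (jacobiWeight (a + 1) (b + 1))
      (jacobiWeight a b x * ((b - a) - (a + b + 2) * x)) x := by
  have h1 : 0 < 1 - x := by linarith [hx.2]
  have h2 : 0 < 1 + x := by linarith [hx.1]
  have d1 : HasDerivAt (fun y : ℝ => (1 - y) ^ (a + 1)) (-1 * (a + 1) * (1 - x) ^ (a + 1 - 1)) x :=
    ((hasDerivAt_id x).const_sub 1).rpow_const (Or.inl h1.ne')
  have d2 : HasDerivAt (fun y : ℝ => (1 + y) ^ (b + 1)) (1 * (b + 1) * (1 + x) ^ (b + 1 - 1)) x :=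
    ((hasDerivAt_id x).const_add 1).rpow_const (Or.inl h2.ne')
  have d := d1.mul d2
  refine HasDerivAt.congr_deriv d ?_
  simp only [jacobiWeight, add_sub_cancel_right]
  rw [Real.rpow_add_one h1.ne', Real.rpow_add_one h2.ne']
  ring

lemma jacobiWeight_succ (a b : ℝ) {x : ℝ} (hx : x ∈ Ioo (-1 : ℝ) 1) :
    jacobiWeight (a + 1) (b + 1) x = jacobiWeight a b x * (1 - x ^ 2) := by
  have h1 : 0 < 1 - x := by linarith [hx.2]
  have h2 : 0 < 1 + x := by linarith [hx.1]
  simp only [jacobiWeight]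
  rw [Real.rpow_add_one h1.ne', Real.rpow_add_one h2.ne']
  ring

lemma jacobiWeight_jac_hasDerivAt (n : ℕ) (a b : ℝ) {x : ℝ} (hx : x ∈ Ioo (-1 : ℝ) 1) :
    HasDerivAt (fun y => jacobiWeight (a + 1) (b + 1) y * jac n (a + 1) (b + 1) y)
      (-2 * ((n : ℝ) + 1) * (jacobiWeight a b x * jac (n + 1) a b x)) x := by
  have := (jacobiWeight_hasDerivAt a b hx).mul (jac_hasDerivAt n (a + 1) (b + 1) x)
  refine HasDerivAt.congr_deriv this ?_
  rw [jacobiWeight_succ a b hx]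
  linear_combination (-jacobiWeight a b x) * jac_succ n a b x

lemma iteratedDeriv_weight (n : ℕ) : ∀ a b x : ℝ, x ∈ Ioo (-1 : ℝ) 1 →
    iteratedDeriv n (fun y => (1 - y) ^ ((n : ℝ) + a) * (1 + y) ^ ((n : ℝ) + b)) x =
      (-2) ^ n * (n.factorial : ℝ) * (jacobiWeight a b x * jac n a b x) := by
  induction n with
  | zero => intro a b x _; simp [jacobiWeight, jac_zero]
  | succ n ih =>
    intro a b x hx
    have he : (fun y : ℝ => (1 - y) ^ (((n + 1 : ℕ) : ℝ) + a) * (1 + y) ^ (((n + 1 : ℕ) : ℝ) + b)) =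
        (fun y : ℝ => (1 - y) ^ ((n : ℝ) + (a + 1)) * (1 + y) ^ ((n : ℝ) + (b + 1))) := by
      funext y; congr 2 <;> push_cast <;> ring
    rw [he, iteratedDeriv_succ]
    have hev : iteratedDeriv n
        (fun y : ℝ => (1 - y) ^ ((n : ℝ) + (a + 1)) * (1 + y) ^ ((n : ℝ) + (b + 1))) =ᶠ[nhds x]
        fun y => (-2) ^ n * (n.factorial : ℝ) *
          (jacobiWeight (a + 1) (b + 1) y * jac n (a + 1) (b + 1) y) := by
      filter_upwards [isOpen_Ioo.mem_nhds hx] with y hy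
      exact ih _ _ _ hy
    rw [hev.deriv_eq, ((jacobiWeight_jac_hasDerivAt n a b hx).const_mul _).deriv]
    rw [Nat.factorial_succ]; push_cast; ring

lemma jacobiP_eq (a b : ℝ) (n : ℕ) {x : ℝ} (hx : x ∈ Ioo (-1 : ℝ) 1) :
    jacobiP a b n x = jac n a b x := by
  have h1 : 0 < 1 - x := by linarith [hx.2]
  have h2 : 0 < 1 + x := by linarith [hx.1]
  unfold jacobiP
  rw [iteratedDeriv_weight n a b x hx, jacobiWeight, Real.rpow_neg h1.le, Real.rpow_neg h2.le]
  have e1 : (1 - x) ^ a ≠ 0 := (Real.rpow_pos_of_pos h1 a).ne'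
  have e2 : (1 + x) ^ b ≠ 0 := (Real.rpow_pos_of_pos h2 b).ne'
  have e3 : (n.factorial : ℝ) ≠ 0 := by positivity
  have e4 : ((-2 : ℝ)) ^ n = (-1) ^ n * 2 ^ n := by rw [← mul_pow]; norm_num
  have e5 : ((-1 : ℝ)) ^ n * (-1) ^ n = 1 := by rw [← mul_pow]; norm_num
  rw [e4]
  field_simp
  linear_combination jac n a b x * e5

open MeasureTheory Set

lemma beta_cpow_eq (a b : ℝ) {x : ℝ} (hx : x ∈ Icc (0 : ℝ) 1) :
    (x : ℂ) ^ (((b + 1 : ℝ) : ℂ) - 1) * (1 - (x : ℂ)) ^ (((a + 1 : ℝ) : ℂ) - 1) =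
      ((x ^ b * (1 - x) ^ a : ℝ) : ℂ) := by
  have h1 : 0 ≤ x := hx.1
  have h2 : 0 ≤ 1 - x := by linarith [hx.2]
  rw [Complex.ofReal_mul, Complex.ofReal_cpow h1, Complex.ofReal_cpow h2]
  push_cast; simp

lemma beta_real_integrable (a b : ℝ) (ha : -1 < a) (hb : -1 < b) :
    IntervalIntegrable (fun x : ℝ => x ^ b * (1 - x) ^ a) volume 0 1 := by
  have h := Complex.betaIntegral_convergent (u := ((b + 1 : ℝ) : ℂ)) (v := ((a + 1 : ℝ) : ℂ))
    (by simp; linarith) (by simp; linarith)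
  rw [intervalIntegrable_iff_integrableOn_Icc_of_le zero_le_one] at h ⊢
  have h2 := h.re
  refine IntegrableOn.congr_fun h2 ?_ measurableSet_Icc
  intro x hx
  simp only
  rw [beta_cpow_eq a b hx]; simp

lemma beta_real_integral (a b : ℝ) (ha : -1 < a) (hb : -1 < b) :
    ∫ x in (0 : ℝ)..1, x ^ b * (1 - x) ^ a =
      Real.Gamma (a + 1) * Real.Gamma (b + 1) / Real.Gamma (a + b + 2) := by
  have h := ProbabilityTheory.beta_eq_betaIntegralReal (b + 1) (a + 1) (by linarith) (by linarith)
  have h2 : Complex.betaIntegral ((b + 1 : ℝ) : ℂ) ((a + 1 : ℝ) : ℂ) =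
      ((∫ x in (0 : ℝ)..1, x ^ b * (1 - x) ^ a : ℝ) : ℂ) := by
    rw [Complex.betaIntegral, ← intervalIntegral.integral_ofReal]
    apply intervalIntegral.integral_congr
    intro x hx
    rw [uIcc_of_le zero_le_one] at hx
    exact beta_cpow_eq a b hx
  rw [h2, Complex.ofReal_re] at h
  rw [← h, ProbabilityTheory.beta, show b + 1 + (a + 1) = a + b + 2 by ring, mul_comm]

lemma weight_comp (a b : ℝ) {x : ℝ} (hx : x ∈ Icc (0 : ℝ) 1) :
    jacobiWeight a b (2 * x + -1) = 2 ^ (a + b) * (x ^ b * (1 - x) ^ a) := by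
  have h1 : 0 ≤ x := hx.1
  have h2 : 0 ≤ 1 - x := by linarith [hx.2]
  rw [jacobiWeight, show 1 - (2 * x + -1) = 2 * (1 - x) by ring,
    show 1 + (2 * x + -1) = 2 * x by ring, Real.mul_rpow (by norm_num) h2,
    Real.mul_rpow (by norm_num) h1, Real.rpow_add (by norm_num)]
  ring

lemma weight_integrable (a b : ℝ) (ha : -1 < a) (hb : -1 < b) :
    IntervalIntegrable (jacobiWeight a b) volume (-1) 1 := by
  have h : IntervalIntegrable (fun x : ℝ => jacobiWeight a b (2 * x + -1)) volume 0 1 := by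
    refine ((beta_real_integrable a b ha hb).const_mul (2 ^ (a + b))).congr ?_
    intro x hx
    rw [uIoc_of_le zero_le_one] at hx
    exact (weight_comp a b ⟨hx.1.le, hx.2⟩).symm
  have h3 := (h.comp_add_right (1 / 2)).comp_mul_left (c := 1 / 2)
  norm_num at h3
  convert h3 using 2
  ring_nf

lemma weight_integral (a b : ℝ) (ha : -1 < a) (hb : -1 < b) :
    ∫ x in (-1 : ℝ)..1, jacobiWeight a b x =
      2 ^ (a + b + 1) * Real.Gamma (a + 1) * Real.Gamma (b + 1) / Real.Gamma (a + b + 2) := by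
  have h1 := intervalIntegral.integral_comp_mul_add (a := (0 : ℝ)) (b := 1) (jacobiWeight a b)
    (c := 2) (by norm_num) (-1)
  rw [show (2 : ℝ) * 0 + -1 = -1 by norm_num, show (2 : ℝ) * 1 + -1 = 1 by norm_num,
    smul_eq_mul] at h1
  have h2 : ∫ x in (0 : ℝ)..1, jacobiWeight a b (2 * x + -1) =
      2 ^ (a + b) * ∫ x in (0 : ℝ)..1, x ^ b * (1 - x) ^ a := by
    rw [← intervalIntegral.integral_const_mul]
    apply intervalIntegral.integral_congr
    intro x hx
    rw [uIcc_of_le zero_le_one] at hx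
    exact weight_comp a b hx
  rw [h2, beta_real_integral a b ha hb] at h1
  rw [Real.rpow_add_one (by norm_num)]
  linear_combination (-2) * h1

lemma weight_continuousOn (a b : ℝ) (ha : 0 ≤ a) (hb : 0 ≤ b) :
    Continuous (jacobiWeight a b) := by
  unfold jacobiWeight
  exact ((continuous_const.sub continuous_id).rpow_const (fun _ => Or.inr ha)).mul
    ((continuous_const.add continuous_id).rpow_const (fun _ => Or.inr hb))

lemma weight_one (a b : ℝ) (ha : 0 < a) : jacobiWeight a b 1 = 0 := by
  simp [jacobiWeight, Real.zero_rpow ha.ne']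

lemma weight_neg_one (a b : ℝ) (hb : 0 < b) : jacobiWeight a b (-1) = 0 := by
  simp [jacobiWeight, Real.zero_rpow hb.ne']

lemma weight_nonneg (a b : ℝ) {x : ℝ} (hx : x ∈ Icc (-1 : ℝ) 1) : 0 ≤ jacobiWeight a b x :=
  mul_nonneg (Real.rpow_nonneg (by linarith [hx.2]) _) (Real.rpow_nonneg (by linarith [hx.1]) _)

lemma weight_pos (a b : ℝ) {x : ℝ} (hx : x ∈ Ioo (-1 : ℝ) 1) : 0 < jacobiWeight a b x :=
  mul_pos (Real.rpow_pos_of_pos (by linarith [hx.2]) _)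
    (Real.rpow_pos_of_pos (by linarith [hx.1]) _)

/-- squared norm, recursion -/
lemma jac_norm_rec (n : ℕ) (a b : ℝ) (ha : -1 < a) (hb : -1 < b) :
    ∫ x in (-1 : ℝ)..1, jac (n + 1) a b x ^ 2 * jacobiWeight a b x =
      ((n : ℝ) + a + b + 2) / (4 * ((n : ℝ) + 1)) *
       ∫ x in (-1 : ℝ)..1, jac n (a + 1) (b + 1) x ^ 2 * jacobiWeight (a + 1) (b + 1) x := by
  have hc : (n : ℝ) + 1 ≠ 0 := by positivity
  have hw : Continuous (jacobiWeight (a + 1) (b + 1)) :=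
    weight_continuousOn _ _ (by linarith) (by linarith)
  have h := intervalIntegral.integral_mul_deriv_eq_deriv_mul_of_hasDerivAt (a := -1) (b := 1)
    (u := jac (n + 1) a b) (u' := jacD (n + 1) a b)
    (v := fun y => jacobiWeight (a + 1) (b + 1) y * jac n (a + 1) (b + 1) y)
    (v' := fun x => (-2 * ((n : ℝ) + 1) * (jacobiWeight a b x * jac (n + 1) a b x)))
    (jac_continuous _ _ _).continuousOn (hw.mul (jac_continuous _ _ _)).continuousOn
    (fun x _ => jac_hasDerivAt _ _ _ _)
    (fun x hx => jacobiWeight_jac_hasDerivAt n a b (by simpa using hx))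
    ((jacD_continuous _ _ _).intervalIntegrable _ _)
    (((weight_integrable a b ha hb).mul_continuousOn (jac_continuous _ _ _).continuousOn).const_mul _)
  simp only [weight_one (a + 1) (b + 1) (by linarith), weight_neg_one (a + 1) (b + 1) (by linarith)]
    at h
  have e1 : ∫ x in (-1 : ℝ)..1, jac (n + 1) a b x *
      (-2 * ((n : ℝ) + 1) * (jacobiWeight a b x * jac (n + 1) a b x)) =
      (-2 * ((n : ℝ) + 1)) * ∫ x in (-1 : ℝ)..1, jac (n + 1) a b x ^ 2 * jacobiWeight a b x := by
    rw [← intervalIntegral.integral_const_mul]; congr 1; funext x; ring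
  have e2 : ∫ x in (-1 : ℝ)..1, jacD (n + 1) a b x *
      (jacobiWeight (a + 1) (b + 1) x * jac n (a + 1) (b + 1) x) =
      (((n : ℝ) + a + b + 2) / 2) *
        ∫ x in (-1 : ℝ)..1, jac n (a + 1) (b + 1) x ^ 2 * jacobiWeight (a + 1) (b + 1) x := by
    rw [← intervalIntegral.integral_const_mul]; congr 1; funext x; rw [jacD_succ]; ring
  rw [e1, e2] at h
  field_simp
  linear_combination (-2) * h

lemma sigma_rec (n : ℕ) (a b : ℝ) (ha : -1 < a) (hb : -1 < b) :
    jacobiSigma a b (n + 1) = ((n : ℝ) + a + b + 2) / (4 * ((n : ℝ) + 1)) *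
      jacobiSigma (a + 1) (b + 1) n := by
  have h0 : 0 ≤ (n : ℝ) := n.cast_nonneg
  have hc : (n : ℝ) + 1 ≠ 0 := by positivity
  have hp : (n : ℝ) + a + b + 2 ≠ 0 := by linarith
  have hq : 2 * (n : ℝ) + a + b + 3 ≠ 0 := by linarith
  have hG : Real.Gamma ((n : ℝ) + a + b + 2) ≠ 0 := (Real.Gamma_pos_of_pos (by linarith)).ne'
  have hf : (n.factorial : ℝ) ≠ 0 := by positivity
  have eG : Real.Gamma ((n : ℝ) + a + b + 2 + 1) = ((n : ℝ) + a + b + 2) *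
    Real.Gamma ((n : ℝ) + a + b + 2) := Real.Gamma_add_one hp
  have e2 : (2 : ℝ) ^ (a + 1 + (b + 1) + 1) = 4 * 2 ^ (a + b + 1) := by
    rw [show a + 1 + (b + 1) + 1 = a + b + 1 + 2 by ring, Real.rpow_add (by norm_num)]
    norm_num; ring
  unfold jacobiSigma
  rw [e2, Nat.factorial_succ]
  push_cast
  rw [show (n : ℝ) + (a + 1) + 1 = n + 1 + a + 1 by ring,
    show (n : ℝ) + (b + 1) + 1 = n + 1 + b + 1 by ring,
    show (n : ℝ) + (a + 1) + (b + 1) + 1 = n + a + b + 2 + 1 by ring, eG,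
    show (n : ℝ) + 1 + a + b + 1 = n + a + b + 2 by ring,
    show 2 * (n : ℝ) + (a + 1) + (b + 1) + 1 = 2 * n + a + b + 3 by ring,
    show 2 * ((n : ℝ) + 1) + a + b + 1 = 2 * n + a + b + 3 by ring]
  field_simp

lemma jac_norm (n : ℕ) : ∀ a b : ℝ, -1 < a → -1 < b → 0 < (n : ℝ) + a + b + 1 →
    ∫ x in (-1 : ℝ)..1, jac n a b x ^ 2 * jacobiWeight a b x = jacobiSigma a b n := by
  induction n with
  | zero =>
    intro a b ha hb h
    simp only [jac_zero, one_pow, one_mul]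
    rw [weight_integral a b ha hb]
    simp only [Nat.cast_zero, zero_add] at h
    have eG : Real.Gamma (a + b + 1 + 1) = (a + b + 1) * Real.Gamma (a + b + 1) :=
      Real.Gamma_add_one h.ne'
    unfold jacobiSigma
    simp only [Nat.cast_zero, zero_add, mul_zero, Nat.factorial_zero, Nat.cast_one, one_mul]
    rw [← eG, show a + b + 1 + 1 = a + b + 2 by ring]
  | succ n ih =>
    intro a b ha hb _
    have h0 : 0 ≤ (n : ℝ) := n.cast_nonneg
    rw [jac_norm_rec n a b ha hb, ih (a + 1) (b + 1) (by linarith) (by linarith) (by linarith),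
      sigma_rec n a b ha hb]

open MeasureTheory Set Filter Topology

lemma Gamma_prod (s : ℝ) (hs : 0 < s) (m : ℕ) :
    Real.Gamma (s + m) = (∏ j ∈ Finset.range m, (s + j)) * Real.Gamma s := by
  induction m with
  | zero => simp
  | succ m ih =>
    rw [Finset.prod_range_succ]
    have : s + (m : ℝ) ≠ 0 := by positivity
    push_cast
    rw [← add_assoc, Real.Gamma_add_one this, ih]; ring

/-- normalised Gamma ratio -/
noncomputable def gamR (s : ℝ) (m : ℕ) : ℝ :=
  Real.Gamma (s + (m + 1 : ℕ)) / ((m : ℝ) ^ s * (m.factorial : ℝ))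

lemma gamR_tendsto (s : ℝ) (hs : 0 < s) : Tendsto (gamR s) atTop (𝓝 1) := by
  have h := Real.GammaSeq_tendsto_Gamma s
  have hG : Real.Gamma s ≠ 0 := (Real.Gamma_pos_of_pos hs).ne'
  have h2 := h.inv₀ hG
  have h3 := h2.mul_const (Real.Gamma s)
  rw [inv_mul_cancel₀ hG] at h3
  refine h3.congr ?_
  intro m
  rw [gamR, Gamma_prod s hs, Real.GammaSeq, inv_div]
  ring

lemma q_tendsto (s : ℝ) : Tendsto (fun m : ℕ => 1 + s / (m : ℝ)) atTop (𝓝 1) := by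
  have := (tendsto_const_div_atTop_nhds_zero_nat s).const_add 1
  simpa using this

lemma sigma_formula (a b : ℝ) (ha : -1 < a) (hb : -1 < b) (m : ℕ) (hm : 2 ≤ m) :
    (m : ℝ) * jacobiSigma a b m = 2 ^ (a + b + 1) *
      (gamR (a + 1) m * gamR (b + 1) m / gamR (a + b + 2) m) *
      ((1 + (a + b + 2) / m) * (1 + (a + b + 1) / m) /
        ((1 + (a + 1) / m) * (1 + (b + 1) / m) * (1 + (1 + (a + b + 1) / m)))) := by
  have hm' : (2 : ℝ) ≤ m := by exact_mod_cast hm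
  have m0 : (m : ℝ) ≠ 0 := by positivity
  have mp : (0 : ℝ) < m := by positivity
  have f0 : (m.factorial : ℝ) ≠ 0 := by positivity
  have p1 : (m : ℝ) + a + 1 ≠ 0 := by linarith
  have p2 : (m : ℝ) + b + 1 ≠ 0 := by linarith
  have p3 : (m : ℝ) + a + b + 2 ≠ 0 := by linarith
  have p4 : (m : ℝ) + a + b + 1 ≠ 0 := by linarith
  have p5 : 2 * (m : ℝ) + a + b + 1 ≠ 0 := by linarith
  have g1 : Real.Gamma (a + 1 + (m + 1 : ℕ)) = (m + a + 1) * Real.Gamma (m + a + 1) := by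
    rw [← Real.Gamma_add_one p1]; push_cast; ring_nf
  have g2 : Real.Gamma (b + 1 + (m + 1 : ℕ)) = (m + b + 1) * Real.Gamma (m + b + 1) := by
    rw [← Real.Gamma_add_one p2]; push_cast; ring_nf
  have g3 : Real.Gamma (a + b + 2 + (m + 1 : ℕ)) =
      (m + a + b + 2) * ((m + a + b + 1) * Real.Gamma (m + a + b + 1)) := by
    rw [← Real.Gamma_add_one p4, show (m : ℝ) + a + b + 1 + 1 = m + a + b + 2 by ring,
      ← Real.Gamma_add_one p3]; push_cast; ring_nf
  have hG : Real.Gamma ((m : ℝ) + a + b + 1) ≠ 0 := (Real.Gamma_pos_of_pos (by linarith)).ne'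
  have er : (m : ℝ) ^ (a + b + 2) = (m : ℝ) ^ (a + 1) * (m : ℝ) ^ (b + 1) := by
    rw [← Real.rpow_add mp]; ring_nf
  have r1 : (m : ℝ) ^ (a + 1) ≠ 0 := (Real.rpow_pos_of_pos mp _).ne'
  have r2 : (m : ℝ) ^ (b + 1) ≠ 0 := (Real.rpow_pos_of_pos mp _).ne'
  unfold gamR
  rw [g1, g2, g3, er]
  unfold jacobiSigma
  have k1 : 1 + (a + 1) / (m : ℝ) = (m + a + 1) / m := by field_simp; ring
  have k2 : 1 + (b + 1) / (m : ℝ) = (m + b + 1) / m := by field_simp; ring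
  have k3 : 1 + (a + b + 2) / (m : ℝ) = (m + a + b + 2) / m := by field_simp; ring
  have k4 : 1 + (a + b + 1) / (m : ℝ) = (m + a + b + 1) / m := by field_simp; ring
  have k5 : 1 + (m + a + b + 1) / (m : ℝ) = (2 * m + a + b + 1) / m := by field_simp; ring
  rw [k1, k2, k3, k4, k5]
  field_simp

lemma sigma_tendsto (a b : ℝ) (ha : -1 < a) (hb : -1 < b) :
    Tendsto (fun m : ℕ => (m : ℝ) * jacobiSigma a b m) atTop (𝓝 (2 ^ (a + b + 1) * (1 / 2))) := by
  have h1 := ((gamR_tendsto (a + 1) (by linarith)).mul (gamR_tendsto (b + 1) (by linarith))).div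
    (gamR_tendsto (a + b + 2) (by linarith)) one_ne_zero
  have h2 := ((q_tendsto (a + b + 2)).mul (q_tendsto (a + b + 1))).div
    (((q_tendsto (a + 1)).mul (q_tendsto (b + 1))).mul ((q_tendsto (a + b + 1)).const_add 1))
    (by norm_num)
  have h3 := (h1.const_mul (2 ^ (a + b + 1))).mul h2
  norm_num at h3
  refine h3.congr' ?_
  filter_upwards [eventually_ge_atTop 2] with m hm
  rw [sigma_formula a b ha hb m hm]

lemma sigma_bounds (a b : ℝ) (ha : -1 < a) (hb : -1 < b) :
    ∃ c C : ℝ, 0 < c ∧ 0 < C ∧ ∃ N : ℕ, ∀ m : ℕ, N ≤ m →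
      c / m ≤ jacobiSigma a b m ∧ jacobiSigma a b m ≤ C / m := by
  have h := sigma_tendsto a b ha hb
  set L : ℝ := 2 ^ (a + b + 1) * (1 / 2) with hL
  have hLp : 0 < L := by positivity
  have e1 := h.eventually (lt_mem_nhds (show L / 2 < L by linarith))
  have e2 := h.eventually (gt_mem_nhds (show L < 2 * L by linarith))
  obtain ⟨N, hN⟩ := eventually_atTop.1 ((e1.and e2).and (eventually_ge_atTop 1))
  refine ⟨L / 2, 2 * L, by linarith, by linarith, N, fun m hm => ?_⟩
  obtain ⟨⟨h1, h2⟩, h3⟩ := hN m hm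
  have mp : (0 : ℝ) < m := by exact_mod_cast h3
  rw [div_le_iff₀ mp, le_div_iff₀ mp]
  constructor <;> linarith [mul_comm (m : ℝ) (jacobiSigma a b m)]

open MeasureTheory Set Filter Topology

lemma jac_L1 (a b : ℝ) (ha : -1 < a) (hb : -1 < b) :
    ∃ C : ℝ, 0 < C ∧ ∃ N : ℕ, ∀ m : ℕ, N ≤ m →
      ∫ x in (-1 : ℝ)..1, |jac m a b x| * jacobiWeight a b x ≤ C * (m : ℝ) ^ (-(1 / 2) : ℝ) := by
  obtain ⟨c, C, hc, hC, N, hN⟩ := sigma_bounds a b ha hb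
  have hW : 0 ≤ ∫ x in (-1 : ℝ)..1, jacobiWeight a b x :=
    intervalIntegral.integral_nonneg (by norm_num) (fun x hx => weight_nonneg a b hx)
  refine ⟨(C + ∫ x in (-1 : ℝ)..1, jacobiWeight a b x) / 2, by positivity, max N 2, fun m hm => ?_⟩
  have hm2 : 2 ≤ m := le_trans (le_max_right _ _) hm
  have hm' : (2 : ℝ) ≤ m := by exact_mod_cast hm2
  have mp : (0 : ℝ) < m := by positivity
  obtain ⟨-, hs⟩ := hN m (le_trans (le_max_left _ _) hm)
  have wi := weight_integrable a b ha hb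
  set r : ℝ := (m : ℝ) ^ (1 / 2 : ℝ) with hr
  have rp : 0 < r := Real.rpow_pos_of_pos mp _
  have hrr : r * r = m := by rw [hr, ← Real.rpow_add mp]; norm_num
  have hri : (m : ℝ) ^ (-(1 / 2) : ℝ) = r⁻¹ := Real.rpow_neg mp.le _
  have h1 : ∫ x in (-1 : ℝ)..1, |jac m a b x| * jacobiWeight a b x ≤
      ∫ x in (-1 : ℝ)..1, (r / 2 * (jac m a b x ^ 2 * jacobiWeight a b x)
        + r⁻¹ / 2 * jacobiWeight a b x) := by
    apply intervalIntegral.integral_mono_on (by norm_num)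
    · exact wi.continuousOn_mul (jac_continuous m a b).abs.continuousOn
    · exact ((wi.continuousOn_mul ((jac_continuous m a b).pow 2).continuousOn).const_mul _).add
        (wi.const_mul _)
    · intro x hx
      have hw := weight_nonneg a b hx
      have : |jac m a b x| ≤ r / 2 * jac m a b x ^ 2 + r⁻¹ / 2 := by
        rw [← sq_abs]
        have h0 : 0 ≤ (r * |jac m a b x| - 1) ^ 2 / (2 * r) := by positivity
        have : (r * |jac m a b x| - 1) ^ 2 / (2 * r) =
          r / 2 * |jac m a b x| ^ 2 + r⁻¹ / 2 - |jac m a b x| := by field_simp; ring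
        linarith
      calc _ ≤ (r / 2 * jac m a b x ^ 2 + r⁻¹ / 2) * jacobiWeight a b x :=
            mul_le_mul_of_nonneg_right this hw
        _ = _ := by ring
  rw [intervalIntegral.integral_add, intervalIntegral.integral_const_mul,
    intervalIntegral.integral_const_mul, jac_norm m a b ha hb (by linarith)] at h1
  · rw [hri]
    have h2 : r / 2 * jacobiSigma a b m ≤ C / 2 * r⁻¹ := by
      calc _ ≤ r / 2 * (C / m) := by gcongr
        _ = C / 2 * r⁻¹ := by rw [← hrr]; field_simp
    linarith
  · exact (wi.continuousOn_mul ((jac_continuous m a b).pow 2).continuousOn).const_mul _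
  · exact wi.const_mul _

lemma jacD_norm (k : ℕ) (a b : ℝ) (ha : -1 < a) (hb : -1 < b) :
    ∫ x in (-1 : ℝ)..1, jacD (k + 1) a b x ^ 2 * jacobiWeight (a + 1) (b + 1) x =
      ((k : ℝ) + 1) * (k + a + b + 2) * jacobiSigma a b (k + 1) := by
  have h0 : 0 ≤ (k : ℝ) := k.cast_nonneg
  have hc : (k : ℝ) + 1 ≠ 0 := by positivity
  have : ∫ x in (-1 : ℝ)..1, jacD (k + 1) a b x ^ 2 * jacobiWeight (a + 1) (b + 1) x =
      (((k : ℝ) + a + b + 2) / 2) ^ 2 *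
        ∫ x in (-1 : ℝ)..1, jac k (a + 1) (b + 1) x ^ 2 * jacobiWeight (a + 1) (b + 1) x := by
    rw [← intervalIntegral.integral_const_mul]; congr 1; funext x; rw [jacD_succ]; ring
  rw [this, jac_norm k (a + 1) (b + 1) (by linarith) (by linarith) (by linarith),
    sigma_rec k a b ha hb]
  field_simp
  ring

/-- energy -/
noncomputable def jacE (m : ℕ) (a b L y : ℝ) : ℝ :=
  jac m a b y ^ 2 + (1 - y ^ 2) * jacD m a b y ^ 2 / L

lemma jacE_hasDerivAt (m : ℕ) (a b y : ℝ) (hL : (m : ℝ) * (m + a + b + 1) ≠ 0) :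
    HasDerivAt (jacE m a b (m * (m + a + b + 1)))
      (2 * ((a + b + 1) * y - (b - a)) * jacD m a b y ^ 2 / (m * (m + a + b + 1))) y := by
  have h1 := (jac_hasDerivAt m a b y).pow 2
  have h2 := (jacD_hasDerivAt m a b y).pow 2
  have h3 := ((hasDerivAt_id y).pow 2).const_sub 1
  have h := h1.add ((h3.mul h2).div_const (m * (m + a + b + 1)))
  refine HasDerivAt.congr_deriv h ?_
  have ode := jac_ode m a b y
  simp only [Pi.pow_apply, id]
  generalize (m : ℝ) * (m + a + b + 1) = L at *
  field_simp
  push_cast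
  linear_combination (2 * jacD m a b y) * ode

lemma jacE_compare (m : ℕ) (a b B : ℝ) (hB : 0 < B) (hB1 : B < 1)
    (hL : 0 < (m : ℝ) * (m + a + b + 1)) (D : ℝ)
    (hD : D = 2 * (|a + b + 1| + |b - a|) / (1 - B ^ 2))
    {x y : ℝ} (hx : x ∈ Icc (-B) B) (hy : y ∈ Icc (-B) B) :
    jacE m a b (m * (m + a + b + 1)) y * Real.exp (-(2 * D)) ≤
      jacE m a b (m * (m + a + b + 1)) x := by
  set L := (m : ℝ) * (m + a + b + 1)
  have hB2 : 0 < 1 - B ^ 2 := by nlinarith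
  have hD0 : 0 ≤ D := by rw [hD]; positivity
  have E0 : ∀ y ∈ Icc (-B) B, 0 ≤ jacE m a b L y := by
    intro y hy
    have : 0 ≤ 1 - y ^ 2 := by nlinarith [hy.1, hy.2]
    unfold jacE; positivity
  have key : ∀ y ∈ Icc (-B) B,
      |2 * ((a + b + 1) * y - (b - a)) * jacD m a b y ^ 2 / L| ≤ D * jacE m a b L y := by
    intro y hy
    have hy1 : |y| ≤ 1 := abs_le.2 ⟨by linarith [hy.1], by linarith [hy.2]⟩
    have hy2 : 1 - B ^ 2 ≤ 1 - y ^ 2 := by nlinarith [hy.1, hy.2]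
    have h1 : |2 * ((a + b + 1) * y - (b - a))| ≤ 2 * (|a + b + 1| + |b - a|) := by
      rw [abs_mul, abs_two]
      gcongr
      refine (abs_sub _ _).trans ?_
      rw [abs_mul]
      gcongr
      exact mul_le_of_le_one_right (abs_nonneg _) hy1
    have h2 : 2 * (|a + b + 1| + |b - a|) = D * (1 - B ^ 2) := by rw [hD]; field_simp
    rw [abs_div, abs_mul, abs_of_pos hL, abs_of_nonneg (sq_nonneg (jacD m a b y))]
    calc _ ≤ D * (1 - B ^ 2) * jacD m a b y ^ 2 / L := by rw [← h2]; gcongr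
      _ ≤ D * ((1 - y ^ 2) * jacD m a b y ^ 2 / L) := by
        rw [mul_assoc, mul_div_assoc]; gcongr
      _ ≤ _ := by unfold jacE; gcongr; linarith [sq_nonneg (jac m a b y)]
  have hder := fun y => jacE_hasDerivAt m a b y hL.ne'
  have hmono : MonotoneOn (fun y => jacE m a b L y * Real.exp (D * y)) (Icc (-B) B) := by
    have hd : ∀ y, HasDerivAt (fun y => jacE m a b L y * Real.exp (D * y))
        (2 * ((a + b + 1) * y - (b - a)) * jacD m a b y ^ 2 / L * Real.exp (D * y)
          + jacE m a b L y * (Real.exp (D * y) * (D * 1))) y := fun y =>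
      (hder y).mul ((hasDerivAt_id y).const_mul D).exp
    apply monotoneOn_of_deriv_nonneg (convex_Icc _ _)
    · exact fun y _ => (hd y).continuousAt.continuousWithinAt
    · exact fun y _ => (hd y).differentiableAt.differentiableWithinAt
    · intro y hy
      rw [interior_Icc] at hy
      rw [(hd y).deriv]
      have := (abs_le.1 (key y ⟨hy.1.le, hy.2.le⟩)).1
      have e := Real.exp_pos (D * y)
      nlinarith
  have hanti : AntitoneOn (fun y => jacE m a b L y * Real.exp (-D * y)) (Icc (-B) B) := by
    have hd : ∀ y, HasDerivAt (fun y => jacE m a b L y * Real.exp (-D * y))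
        (2 * ((a + b + 1) * y - (b - a)) * jacD m a b y ^ 2 / L * Real.exp (-D * y)
          + jacE m a b L y * (Real.exp (-D * y) * (-D * 1))) y := fun y =>
      (hder y).mul ((hasDerivAt_id y).const_mul (-D)).exp
    apply antitoneOn_of_deriv_nonpos (convex_Icc _ _)
    · exact fun y _ => (hd y).continuousAt.continuousWithinAt
    · exact fun y _ => (hd y).differentiableAt.differentiableWithinAt
    · intro y hy
      rw [interior_Icc] at hy
      rw [(hd y).deriv]
      have := (abs_le.1 (key y ⟨hy.1.le, hy.2.le⟩)).2
      have e := Real.exp_pos (-D * y)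
      nlinarith
  rcases le_total x y with hxy | hxy
  · have h := hanti hx hy hxy
    simp only at h
    have h2 : jacE m a b L y * Real.exp (-(2 * D)) ≤
        jacE m a b L y * Real.exp (-D * y) * Real.exp (D * x) := by
      rw [mul_assoc, ← Real.exp_add]
      have := E0 y hy
      gcongr
      nlinarith [hx.1, hx.2, hy.1, hy.2]
    refine h2.trans ?_
    calc _ ≤ jacE m a b L x * Real.exp (-D * x) * Real.exp (D * x) := by gcongr
      _ = _ := by rw [mul_assoc, ← Real.exp_add]; simp
  · have h := hmono hy hx hxy
    simp only at h
    have h2 : jacE m a b L y * Real.exp (-(2 * D)) ≤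
        jacE m a b L y * Real.exp (D * y) * Real.exp (-D * x) := by
      rw [mul_assoc, ← Real.exp_add]
      have := E0 y hy
      gcongr
      nlinarith [hx.1, hx.2, hy.1, hy.2]
    refine h2.trans ?_
    calc _ ≤ jacE m a b L x * Real.exp (D * x) * Real.exp (-D * x) := by gcongr
      _ = _ := by rw [mul_assoc, ← Real.exp_add]; simp

lemma weight_lower (a b B : ℝ) (hB : 0 < B) (hB1 : B < 1) :
    ∃ w : ℝ, 0 < w ∧ ∀ y ∈ Icc (-B) B, w ≤ jacobiWeight a b y := by
  have hc : ContinuousOn (jacobiWeight a b) (Icc (-B) B) := by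
    unfold jacobiWeight
    apply ContinuousOn.mul
    · exact ContinuousOn.rpow_const (by fun_prop) (fun x hx => Or.inl (by linarith [hx.2]))
    · exact ContinuousOn.rpow_const (by fun_prop) (fun x hx => Or.inl (by linarith [hx.1]))
  obtain ⟨y, hy, hmin⟩ := isCompact_Icc.exists_isMinOn ⟨0, by constructor <;> linarith⟩ hc
  refine ⟨jacobiWeight a b y, weight_pos a b ⟨by linarith [hy.1], by linarith [hy.2]⟩, ?_⟩
  intro x hx
  exact hmin hx

lemma jacE_integral (k : ℕ) (a b B w : ℝ) (ha : -1 < a) (hb : -1 < b) (hB : 0 < B) (hB1 : B < 1)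
    (hw0 : 0 < w) (hw : ∀ y ∈ Icc (-B) B, w ≤ jacobiWeight a b y) :
    w * ∫ y in (-B)..B, jacE (k + 1) a b (((k : ℝ) + 1) * (k + a + b + 2)) y ≤
      2 * jacobiSigma a b (k + 1) := by
  have h0 : 0 ≤ (k : ℝ) := k.cast_nonneg
  set L := ((k : ℝ) + 1) * (k + a + b + 2) with hL
  have hLp : 0 < L := by
    have : 0 < (k : ℝ) + a + b + 2 := by linarith
    positivity
  have wi := weight_integrable a b ha hb
  have wi' := weight_integrable (a + 1) (b + 1) (by linarith) (by linarith)
  have i1 : IntervalIntegrable (fun x => jac (k + 1) a b x ^ 2 * jacobiWeight a b x)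
      volume (-1) 1 := wi.continuousOn_mul ((jac_continuous (k + 1) a b).pow 2).continuousOn
  have i2 : IntervalIntegrable (fun x => jacD (k + 1) a b x ^ 2 * jacobiWeight (a + 1) (b + 1) x)
      volume (-1) 1 := wi'.continuousOn_mul ((jacD_continuous (k + 1) a b).pow 2).continuousOn
  have hE : Continuous (jacE (k + 1) a b L) := by
    unfold jacE
    have := jac_continuous (k + 1) a b
    have := jacD_continuous (k + 1) a b
    fun_prop
  set F : ℝ → ℝ := fun x => jac (k + 1) a b x ^ 2 * jacobiWeight a b x +
      1 / L * (jacD (k + 1) a b x ^ 2 * jacobiWeight (a + 1) (b + 1) x) with hF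
  have iF : IntervalIntegrable F volume (-1) 1 := i1.add (i2.const_mul _)
  have hFI : ∫ x in (-1 : ℝ)..1, F x = 2 * jacobiSigma a b (k + 1) := by
    simp only [hF]
    rw [intervalIntegral.integral_add i1 (i2.const_mul _), intervalIntegral.integral_const_mul,
      jacD_norm k a b ha hb, jac_norm (k + 1) a b ha hb (by push_cast; linarith), ← hL]
    field_simp; ring
  have F0 : ∀ x ∈ Icc (-1 : ℝ) 1, 0 ≤ F x := by
    intro x hx
    have := weight_nonneg a b hx
    have := weight_nonneg (a + 1) (b + 1) hx
    simp only [hF]; positivity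
  rw [← hFI, ← intervalIntegral.integral_const_mul]
  calc _ ≤ ∫ x in (-B)..B, F x := by
        apply intervalIntegral.integral_mono_on (by linarith)
        · exact (hE.intervalIntegrable _ _).const_mul _
        · apply iF.mono_set
          rw [uIcc_of_le (by linarith), uIcc_of_le (by norm_num)]
          exact Icc_subset_Icc (by linarith) (by linarith)
        · intro x hx
          have hx' : x ∈ Ioo (-1 : ℝ) 1 := ⟨by linarith [hx.1], by linarith [hx.2]⟩
          have e : F x = jacobiWeight a b x * jacE (k + 1) a b L x := by
            simp only [hF, jacE, jacobiWeight_succ a b hx']; ring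
          rw [e]
          apply mul_le_mul_of_nonneg_right (hw x hx)
          have : 0 ≤ 1 - x ^ 2 := by nlinarith [hx'.1, hx'.2]
          unfold jacE; positivity
    _ ≤ _ := by
        apply intervalIntegral.integral_mono_interval (by linarith) (by linarith) (by linarith)
        · rw [EventuallyLE, ae_restrict_iff' measurableSet_Ioc]
          exact Eventually.of_forall fun x hx => F0 x ⟨hx.1.le, hx.2⟩
        · exact iF

lemma jac_sup (a b B : ℝ) (ha : -1 < a) (hb : -1 < b) (hB : 0 < B) (hB1 : B < 1) :
    ∃ C : ℝ, 0 < C ∧ ∃ N : ℕ, ∀ m : ℕ, N ≤ m → ∀ y ∈ Icc (-B) B,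
      |jac m a b y| ≤ C * (m : ℝ) ^ (-(1 / 2) : ℝ) := by
  obtain ⟨c, C, hc, hC, N, hN⟩ := sigma_bounds a b ha hb
  obtain ⟨w, hw0, hw⟩ := weight_lower a b B hB hB1
  set D : ℝ := 2 * (|a + b + 1| + |b - a|) / (1 - B ^ 2) with hD
  set A : ℝ := C * Real.exp (2 * D) / (B * w) with hA
  have hAp : 0 < A := by positivity
  refine ⟨Real.sqrt A, Real.sqrt_pos.2 hAp, max N 2, fun m hm y hy => ?_⟩
  obtain ⟨k, rfl⟩ : ∃ k, m = k + 1 := ⟨m - 1, by have := le_trans (le_max_right N 2) hm; omega⟩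
  have hs := (hN (k + 1) (le_trans (le_max_left _ _) hm)).2
  have h0 : 0 ≤ (k : ℝ) := k.cast_nonneg
  have hLe : (((k + 1 : ℕ) : ℝ)) * ((k + 1 : ℕ) + a + b + 1) = ((k : ℝ) + 1) * (k + a + b + 2) := by
    push_cast; ring
  have hLp : 0 < ((k : ℝ) + 1) * (k + a + b + 2) := by
    have : 0 < (k : ℝ) + a + b + 2 := by linarith
    positivity
  have hIntg := jacE_integral k a b B w ha hb hB hB1 hw0 hw
  have hcmp : ∀ x ∈ Icc (-B) B, jacE (k + 1) a b (((k : ℝ) + 1) * (k + a + b + 2)) y *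
      Real.exp (-(2 * D)) ≤ jacE (k + 1) a b (((k : ℝ) + 1) * (k + a + b + 2)) x := by
    intro x hx
    have := jacE_compare (k + 1) a b B hB hB1 (by rw [hLe]; exact hLp) D hD hx hy
    rwa [hLe] at this
  set L := ((k : ℝ) + 1) * (k + a + b + 2) with hL
  have hE : Continuous (jacE (k + 1) a b L) := by
    unfold jacE
    have := jac_continuous (k + 1) a b
    have := jacD_continuous (k + 1) a b
    fun_prop
  have h1 : ∫ x in (-B)..B, jacE (k + 1) a b L y * Real.exp (-(2 * D)) ≤
      ∫ x in (-B)..B, jacE (k + 1) a b L x :=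
    intervalIntegral.integral_mono_on (by linarith) intervalIntegrable_const
      (hE.intervalIntegrable _ _) hcmp
  rw [intervalIntegral.integral_const, smul_eq_mul] at h1
  have h2 : w * ((B - -B) * (jacE (k + 1) a b L y * Real.exp (-(2 * D)))) ≤
      2 * (C / ((k + 1 : ℕ) : ℝ)) := by
    calc _ ≤ _ := mul_le_mul_of_nonneg_left h1 hw0.le
      _ ≤ _ := hIntg
      _ ≤ _ := by gcongr
  have mp : (0 : ℝ) < ((k + 1 : ℕ) : ℝ) := by positivity
  have h3 : jacE (k + 1) a b L y ≤ A / ((k + 1 : ℕ) : ℝ) := by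
    rw [Real.exp_neg] at h2
    have e := Real.exp_pos (2 * D)
    have : jacE (k + 1) a b L y =
      (w * ((B - -B) * (jacE (k + 1) a b L y * (Real.exp (2 * D))⁻¹))) *
        (Real.exp (2 * D) / (2 * B * w)) := by field_simp; ring
    rw [this]
    calc _ ≤ 2 * (C / ((k + 1 : ℕ) : ℝ)) * (Real.exp (2 * D) / (2 * B * w)) := by gcongr
      _ = _ := by rw [hA]; field_simp
  have h4 : jac (k + 1) a b y ^ 2 ≤ A / ((k + 1 : ℕ) : ℝ) := by
    refine le_trans ?_ h3
    have : 0 ≤ 1 - y ^ 2 := by nlinarith [hy.1, hy.2]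
    unfold jacE
    have : 0 ≤ (1 - y ^ 2) * jacD (k + 1) a b y ^ 2 / L := by positivity
    linarith
  have h5 := Real.abs_le_sqrt h4
  rw [Real.sqrt_div hAp.le, Real.sqrt_eq_rpow ((k + 1 : ℕ) : ℝ)] at h5
  rw [Real.rpow_neg mp.le, ← div_eq_mul_inv]
  exact h5

open MeasureTheory Set Filter Topology

/-- iterated antiderivatives of `P_n ω` -/
noncomputable def jG (a b : ℝ) (n k : ℕ) (y : ℝ) : ℝ :=
  (-1) ^ k / (2 ^ k * (n.descFactorial k : ℝ)) *
    (jacobiWeight (a + k) (b + k) y * jac (n - k) (a + k) (b + k) y)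

/-- A tower of iterated antiderivatives with the expected decay. -/
structure GT (K n : ℕ) (B P : ℝ) (G : ℕ → ℝ → ℝ) : Prop where
  int0 : IntervalIntegrable (G 0) volume (-1) 1
  cont0 : ContinuousOn (G 0) (Ioo (-1 : ℝ) 1)
  cont : ∀ k, 1 ≤ k → k ≤ K → Continuous (G k)
  zeroL : ∀ k, 1 ≤ k → k ≤ K → G k (-1) = 0
  zeroR : ∀ k, 1 ≤ k → k ≤ K → G k 1 = 0
  der : ∀ k, k < K → ∀ y ∈ Ioo (-1 : ℝ) 1, HasDerivAt (G (k + 1)) (G k y) y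
  sup : ∀ k, k ≤ K → ∀ y ∈ Icc (-B) B, |G k y| ≤ P * (n : ℝ) ^ (-(1 / 2) - k : ℝ)
  l1 : ∀ k, k ≤ K → ∫ y in (-1 : ℝ)..1, |G k y| ≤ P * (n : ℝ) ^ (-(1 / 2) - k : ℝ)

lemma jG_der (a b : ℝ) (n k : ℕ) (hk : k < n) {y : ℝ} (hy : y ∈ Ioo (-1 : ℝ) 1) :
    HasDerivAt (jG a b n (k + 1)) (jG a b n k y) y := by
  obtain ⟨m, rfl⟩ : ∃ m, n = k + 1 + m := ⟨n - (k + 1), by omega⟩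
  have h := (jacobiWeight_jac_hasDerivAt m (a + k) (b + k) hy).const_mul
    ((-1 : ℝ) ^ (k + 1) / (2 ^ (k + 1) * ((k + 1 + m).descFactorial (k + 1) : ℝ)))
  have e1 : k + 1 + m - (k + 1) = m := by omega
  have e2 : k + 1 + m - k = m + 1 := by omega
  have hd : ((k + 1 + m).descFactorial k : ℝ) ≠ 0 := by
    have : 0 < (k + 1 + m).descFactorial k := Nat.descFactorial_pos.2 (by omega)
    positivity
  have hm : (m : ℝ) + 1 ≠ 0 := by positivity
  have : jG a b (k + 1 + m) (k + 1) = fun y =>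
      (-1 : ℝ) ^ (k + 1) / (2 ^ (k + 1) * ((k + 1 + m).descFactorial (k + 1) : ℝ)) *
      (jacobiWeight (a + k + 1) (b + k + 1) y * jac m (a + k + 1) (b + k + 1) y) := by
    funext y
    simp only [jG, e1]; push_cast; simp only [add_assoc]
  rw [this]
  refine HasDerivAt.congr_deriv h ?_
  simp only [jG, e2]
  rw [Nat.descFactorial_succ, e2]
  push_cast
  field_simp
  ring

lemma desc_bound (n k : ℕ) (hk : 2 * k ≤ n) (hn : 1 ≤ n) :
    |(-1 : ℝ) ^ k / (2 ^ k * (n.descFactorial k : ℝ))| ≤ (n : ℝ) ^ (-(k : ℝ)) := by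
  have np : (0 : ℝ) < n := by exact_mod_cast hn
  rw [Real.rpow_neg np.le, Real.rpow_natCast, abs_div, abs_pow, abs_neg, abs_one, one_pow, one_div]
  have h1 : (n + 1 - k) ^ k ≤ n.descFactorial k := Nat.pow_sub_le_descFactorial n k
  have h2 : ((n : ℝ) / 2) ^ k ≤ (n.descFactorial k : ℝ) := by
    have h3 : ((n + 1 - k : ℕ) : ℝ) ^ k ≤ (n.descFactorial k : ℝ) := by exact_mod_cast h1
    refine le_trans ?_ h3
    gcongr
    have h4 : n ≤ 2 * (n + 1 - k) := by omega
    have h5 : (n : ℝ) ≤ 2 * ((n + 1 - k : ℕ) : ℝ) := by exact_mod_cast h4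
    linarith
  have h6 : (n : ℝ) ^ k ≤ 2 ^ k * (n.descFactorial k : ℝ) := by
    calc (n : ℝ) ^ k = 2 ^ k * ((n : ℝ) / 2) ^ k := by rw [← mul_pow]; congr 1; ring
      _ ≤ _ := by gcongr
  rw [abs_of_nonneg (by positivity)]
  gcongr

lemma shift_half (n k : ℕ) (hk : 2 * k ≤ n) (hn : 1 ≤ n) :
    ((n - k : ℕ) : ℝ) ^ (-(1 / 2) : ℝ) ≤ 2 * (n : ℝ) ^ (-(1 / 2) : ℝ) := by
  have np : (0 : ℝ) < n := by exact_mod_cast hn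
  have h4 : n ≤ 2 * (n - k) := by omega
  have h5 : (n : ℝ) ≤ 2 * ((n - k : ℕ) : ℝ) := by exact_mod_cast h4
  calc ((n - k : ℕ) : ℝ) ^ (-(1 / 2) : ℝ) ≤ ((n : ℝ) / 2) ^ (-(1 / 2) : ℝ) :=
        Real.rpow_le_rpow_of_nonpos (by positivity) (by linarith) (by norm_num)
    _ = 2 ^ (1 / 2 : ℝ) * (n : ℝ) ^ (-(1 / 2) : ℝ) := by
        rw [Real.div_rpow np.le (by norm_num), Real.rpow_neg (by norm_num : (0 : ℝ) ≤ 2)]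
        field_simp
    _ ≤ _ := by
        gcongr
        calc (2 : ℝ) ^ (1 / 2 : ℝ) ≤ 2 ^ (1 : ℝ) :=
              Real.rpow_le_rpow_of_exponent_le (by norm_num) (by norm_num)
          _ = 2 := by norm_num

lemma jG_bounds (a b B : ℝ) (ha : -1 < a) (hb : -1 < b) (hB : 0 < B) (hB1 : B < 1) (k : ℕ) :
    ∃ P : ℝ, 0 < P ∧ ∃ N : ℕ, ∀ n : ℕ, N ≤ n →
      (∀ y ∈ Icc (-B) B, |jG a b n k y| ≤ P * (n : ℝ) ^ (-(1 / 2) - k : ℝ)) ∧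
      ∫ y in (-1 : ℝ)..1, |jG a b n k y| ≤ P * (n : ℝ) ^ (-(1 / 2) - k : ℝ) := by
  have hk0 : (0 : ℝ) ≤ k := k.cast_nonneg
  obtain ⟨C1, hC1, N1, h1⟩ := jac_sup (a + k) (b + k) B (by linarith) (by linarith) hB hB1
  obtain ⟨C2, hC2, N2, h2⟩ := jac_L1 (a + k) (b + k) (by linarith) (by linarith)
  have hc : ContinuousOn (jacobiWeight (a + k) (b + k)) (Icc (-B) B) := by
    unfold jacobiWeight
    apply ContinuousOn.mul
    · exact ContinuousOn.rpow_const (by fun_prop) (fun x hx => Or.inl (by linarith [hx.2]))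
    · exact ContinuousOn.rpow_const (by fun_prop) (fun x hx => Or.inl (by linarith [hx.1]))
  obtain ⟨W, hW⟩ := isCompact_Icc.exists_bound_of_continuousOn hc
  have hW0 : 0 ≤ W := le_trans (norm_nonneg _) (hW 0 ⟨by linarith, by linarith⟩)
  refine ⟨W * (C1 * 2) + C2 * 2, by positivity, N1 + N2 + 2 * k + 1, fun n hn => ?_⟩
  have hn1 : 1 ≤ n := by omega
  have np : (0 : ℝ) < n := by exact_mod_cast hn1
  have e : (n : ℝ) ^ (-(1 / 2) - k : ℝ) = (n : ℝ) ^ (-(k : ℝ)) * (n : ℝ) ^ (-(1 / 2) : ℝ) := by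
    rw [← Real.rpow_add np]; congr 1; ring
  have hd := desc_bound n k (by omega) hn1
  have hs := shift_half n k (by omega) hn1
  have p1 : 0 < (n : ℝ) ^ (-(k : ℝ)) := Real.rpow_pos_of_pos np _
  have p2 : 0 < (n : ℝ) ^ (-(1 / 2) : ℝ) := Real.rpow_pos_of_pos np _
  constructor
  · intro y hy
    have hj := h1 (n - k) (by omega) y hy
    have hw : |jacobiWeight (a + k) (b + k) y| ≤ W := hW y hy
    rw [jG, abs_mul, abs_mul, e]
    calc _ ≤ (n : ℝ) ^ (-(k : ℝ)) * (W * (C1 * (2 * (n : ℝ) ^ (-(1 / 2) : ℝ)))) := by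
          gcongr
          exact hj.trans (by gcongr)
      _ ≤ _ := by
          have : 0 ≤ C2 * 2 * ((n : ℝ) ^ (-(k : ℝ)) * (n : ℝ) ^ (-(1 / 2) : ℝ)) := by positivity
          nlinarith
  · have hj := h2 (n - k) (by omega)
    have : ∫ y in (-1 : ℝ)..1, |jG a b n k y| =
        |(-1 : ℝ) ^ k / (2 ^ k * (n.descFactorial k : ℝ))| *
        ∫ y in (-1 : ℝ)..1, |jac (n - k) (a + k) (b + k) y| * jacobiWeight (a + k) (b + k) y := by
      rw [← intervalIntegral.integral_const_mul]
      apply intervalIntegral.integral_congr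
      intro y hy
      rw [uIcc_of_le (by norm_num)] at hy
      simp only [jG]
      rw [abs_mul, abs_mul, abs_of_nonneg (weight_nonneg (a + k) (b + k) hy)]
      ring
    rw [this, e]
    calc _ ≤ (n : ℝ) ^ (-(k : ℝ)) * (C2 * (2 * (n : ℝ) ^ (-(1 / 2) : ℝ))) := by
          apply mul_le_mul hd (hj.trans (by gcongr)) _ p1.le
          apply intervalIntegral.integral_nonneg (by norm_num)
          intro y hy
          have := weight_nonneg (a + k) (b + k) hy
          positivity
      _ ≤ _ := by
          have : 0 ≤ W * (C1 * 2) * ((n : ℝ) ^ (-(k : ℝ)) * (n : ℝ) ^ (-(1 / 2) : ℝ)) := by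
            positivity
          nlinarith

lemma jG_zero (a b : ℝ) (n : ℕ) :
    jG a b n 0 = fun y => jacobiWeight a b y * jac n a b y := by
  funext y; simp [jG]

theorem jG_GT (a b B : ℝ) (ha : -1 < a) (hb : -1 < b) (hB : 0 < B) (hB1 : B < 1) (K : ℕ) :
    ∃ P : ℝ, 0 < P ∧ ∃ N : ℕ, ∀ n : ℕ, N ≤ n → GT K n B P (jG a b n) := by
  choose P hP N h using jG_bounds a b B ha hb hB hB1
  refine ⟨∑ k ∈ Finset.range (K + 1), P k, Finset.sum_pos (fun k _ => hP k) ⟨0, by simp⟩,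
    (∑ k ∈ Finset.range (K + 1), N k) + K, fun n hn => ?_⟩
  have hle : ∀ k, k ≤ K → N k ≤ n ∧ P k ≤ ∑ k ∈ Finset.range (K + 1), P k := by
    intro k hk
    have hm : k ∈ Finset.range (K + 1) := Finset.mem_range.2 (by omega)
    have h1 := Finset.single_le_sum (f := N) (fun i _ => Nat.zero_le _) hm
    exact ⟨by omega, Finset.single_le_sum (f := P) (fun i _ => (hP i).le) hm⟩
  have hpos : ∀ k : ℕ, 1 ≤ k → 0 < a + (k : ℝ) ∧ 0 < b + (k : ℝ) := by
    intro k hk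
    have : (1 : ℝ) ≤ k := by exact_mod_cast hk
    exact ⟨by linarith, by linarith⟩
  have hnn : ∀ k : ℕ, (0 : ℝ) ≤ (n : ℝ) ^ (-(1 / 2) - k : ℝ) := fun k =>
    Real.rpow_nonneg n.cast_nonneg _
  refine ⟨?_, ?_, ?_, ?_, ?_, ?_, ?_, ?_⟩
  · have := ((weight_integrable a b ha hb).mul_continuousOn (jac_continuous n a b).continuousOn)
    rw [jG_zero]; exact this
  · have : ContinuousOn (jacobiWeight a b) (Ioo (-1) 1) := by
      unfold jacobiWeight
      apply ContinuousOn.mul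
      · exact ContinuousOn.rpow_const (by fun_prop) (fun x hx => Or.inl (by linarith [hx.2]))
      · exact ContinuousOn.rpow_const (by fun_prop) (fun x hx => Or.inl (by linarith [hx.1]))
    rw [jG_zero]; exact this.mul (jac_continuous n a b).continuousOn
  · intro k hk _
    exact continuous_const.mul ((weight_continuousOn _ _ (hpos k hk).1.le (hpos k hk).2.le).mul
      (jac_continuous _ _ _))
  · intro k hk _
    simp [jG, weight_neg_one _ _ (hpos k hk).2]
  · intro k hk _
    simp [jG, weight_one _ _ (hpos k hk).1]
  · intro k hk y hy
    exact jG_der a b n k (by omega) hy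
  · intro k hk y hy
    exact ((h k n (hle k hk).1).1 y hy).trans (mul_le_mul_of_nonneg_right (hle k hk).2 (hnn k))
  · intro k hk
    exact ((h k n (hle k hk).1).2).trans (mul_le_mul_of_nonneg_right (hle k hk).2 (hnn k))

open MeasureTheory Set Filter Topology

lemma GT.intG {K n : ℕ} {B P : ℝ} {G : ℕ → ℝ → ℝ} (hG : GT K n B P G) (k : ℕ) (hk : k ≤ K)
    {c d : ℝ} (hc : -1 ≤ c) (hcd : c ≤ d) (hd : d ≤ 1) :
    IntervalIntegrable (G k) volume c d := by
  rcases Nat.eq_zero_or_pos k with rfl | h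
  · apply hG.int0.mono_set
    rw [uIcc_of_le hcd, uIcc_of_le (by norm_num)]
    exact Icc_subset_Icc hc hd
  · exact (hG.cont k h hk).intervalIntegrable _ _

lemma ibp_aux {K n : ℕ} {B P : ℝ} {G : ℕ → ℝ → ℝ} (hG : GT K n B P G) {c : ℝ} (hc : -1 ≤ c)
    (hc1 : c ≤ 1) (H : ℕ → ℝ → ℝ) (hcont : ∀ j ≤ K, ContinuousOn (H j) (Icc c 1))
    (hder : ∀ j < K, ∀ y ∈ Ioo c 1, HasDerivAt (H j) (H (j + 1) y) y) (m : ℕ) (hm : m ≤ K) :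
    |∫ y in c..1, H 0 y * G 0 y| ≤
      (∑ j ∈ Finset.range m, |H j c| * |G (j + 1) c|) + |∫ y in c..1, H m y * G m y| := by
  induction m with
  | zero => simp
  | succ m ih =>
    refine (ih (by omega)).trans ?_
    rw [Finset.sum_range_succ, add_assoc]
    gcongr
    have h := intervalIntegral.integral_mul_deriv_eq_deriv_mul_of_hasDerivAt
      (a := c) (b := 1) (u := H m) (v := G (m + 1)) (u' := H (m + 1)) (v' := G m)
      (by rw [uIcc_of_le hc1]; exact hcont m (by omega))
      (hG.cont (m + 1) (by omega) hm).continuousOn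
      (by rw [min_eq_left hc1, max_eq_right hc1]; exact hder m (by omega))
      (by
        rw [min_eq_left hc1, max_eq_right hc1]
        intro y hy
        exact hG.der m (by omega) y ⟨by linarith [hy.1], hy.2⟩)
      (by
        apply ContinuousOn.intervalIntegrable
        rw [uIcc_of_le hc1]; exact hcont (m + 1) hm)
      (hG.intG m (by omega) hc hc1 le_rfl)
    rw [h, hG.zeroR (m + 1) (by omega) hm, mul_zero, zero_sub, ← abs_mul]
    calc _ ≤ |-(H m c * G (m + 1) c)| + |∫ y in c..1, H (m + 1) y * G (m + 1) y| := abs_sub _ _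
      _ = _ := by rw [abs_neg]

lemma ibp {K n : ℕ} {B P : ℝ} {G : ℕ → ℝ → ℝ} (hG : GT K n B P G) {c : ℝ} (hc : -1 ≤ c)
    (hc1 : c ≤ 1) (H : ℕ → ℝ → ℝ) (hcont : ∀ j ≤ K, ContinuousOn (H j) (Icc c 1))
    (hder : ∀ j < K, ∀ y ∈ Ioo c 1, HasDerivAt (H j) (H (j + 1) y) y) :
    |∫ y in c..1, H 0 y * G 0 y| ≤
      (∑ j ∈ Finset.range K, |H j c| * |G (j + 1) c|) + ∫ y in c..1, |H K y * G K y| := by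
  refine (ibp_aux hG hc hc1 H hcont hder K le_rfl).trans ?_
  gcongr
  exact intervalIntegral.abs_integral_le_integral_abs hc1

lemma smooth_decay {K n : ℕ} {B P M : ℝ} {G : ℕ → ℝ → ℝ} (hG : GT K n B P G) 
    (H : ℕ → ℝ → ℝ) (hcont : ∀ j ≤ K, ContinuousOn (H j) (Icc (-1) 1))
    (hder : ∀ j < K, ∀ y ∈ Ioo (-1 : ℝ) 1, HasDerivAt (H j) (H (j + 1) y) y)
    (hM : ∀ y ∈ Icc (-1 : ℝ) 1, |H K y| ≤ M) :
    |∫ y in (-1 : ℝ)..1, H 0 y * G 0 y| ≤ M * (P * (n : ℝ) ^ (-(1 / 2) - K : ℝ)) := by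
  have hM0 : 0 ≤ M := (abs_nonneg _).trans (hM 0 (by simp))
  refine (ibp hG le_rfl (by norm_num) H hcont hder).trans ?_
  have : ∑ j ∈ Finset.range K, |H j (-1)| * |G (j + 1) (-1)| = 0 := by
    apply Finset.sum_eq_zero
    intro j hj
    rw [hG.zeroL (j + 1) (by omega) (by have := Finset.mem_range.1 hj; omega)]
    simp
  rw [this, zero_add]
  have hi := hG.intG K le_rfl le_rfl (by norm_num : (-1 : ℝ) ≤ 1) le_rfl
  calc _ ≤ ∫ y in (-1 : ℝ)..1, M * |G K y| := by
        apply intervalIntegral.integral_mono_on (by norm_num)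
        · apply IntervalIntegrable.abs
          apply hi.continuousOn_mul
          rw [uIcc_of_le (by norm_num)]; exact hcont K le_rfl
        · exact hi.abs.const_mul _
        · intro y hy
          rw [abs_mul]
          exact mul_le_mul_of_nonneg_right (hM y hy) (abs_nonneg _)
    _ = M * ∫ y in (-1 : ℝ)..1, |G K y| := intervalIntegral.integral_const_mul _ _
    _ ≤ _ := mul_le_mul_of_nonneg_left (hG.l1 K le_rfl) hM0

open MeasureTheory Set Filter Topology

lemma rpow_sub_integrable (r s c d : ℝ) (hr : -1 < r) :
    IntervalIntegrable (fun y : ℝ => (y - s) ^ r) volume c d := by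
  have h := (intervalIntegral.intervalIntegrable_rpow' (a := c - s) (b := d - s) hr)
  have := h.comp_sub_right s
  simpa using this

lemma osc_near {K n : ℕ} {B P M lam s c0 c : ℝ} {G : ℕ → ℝ → ℝ} (hG : GT K n B P G) 
    (hlam : 0 < lam) (hM : 0 ≤ M) (hP : 0 ≤ P) (hn : 1 ≤ n)
    (H : ℝ → ℝ) (hcont : ContinuousOn H (Ioi s))
    (hsup : ∀ y, s < y → B < |y| → H y = 0)
    (hnear : ∀ y, s < y → y - s ≤ 1 → |H y| ≤ M * (y - s) ^ (lam - 1))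
    (hc0 : -1 ≤ c0) (hcc : c0 ≤ c) (hc1 : c ≤ 1) (hs : s ≤ c0) (hcn : c - s ≤ 1 / n) :
    IntervalIntegrable (fun y => H y * G 0 y) volume c0 c ∧
    |∫ y in c0..c, H y * G 0 y| ≤ (1 / lam) * (M * (P * (n : ℝ) ^ (-(1 / 2) - lam : ℝ))) := by
  have np : (0 : ℝ) < n := by exact_mod_cast hn
  have n1 : 1 / (n : ℝ) ≤ 1 := by
    rw [div_le_one np]; exact_mod_cast hn
  set Q := M * (P * (n : ℝ) ^ (-(1 / 2) : ℝ)) with hQ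
  have hQ0 : 0 ≤ Q := by positivity
  have hIntg := rpow_sub_integrable (lam - 1) s c0 c (by linarith)
  have hbd : ∀ y ∈ Ioc c0 c, ‖H y * G 0 y‖ ≤ Q * (y - s) ^ (lam - 1) := by
    intro y hy
    have hys : s < y := by linarith [hy.1]
    have hpos : 0 ≤ (y - s) ^ (lam - 1) := Real.rpow_nonneg (by linarith) _
    by_cases hB : B < |y|
    · rw [hsup y hys hB]; simp; positivity
    · have h1 := hnear y hys (by linarith [hy.2])
      have h2 := hG.sup 0 (Nat.zero_le _) y (abs_le.1 (not_lt.1 hB))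
      simp only [Nat.cast_zero, sub_zero] at h2
      rw [norm_mul]
      calc |H y| * |G 0 y| ≤ (M * (y - s) ^ (lam - 1)) * (P * (n : ℝ) ^ (-(1 / 2) : ℝ)) := by
            gcongr
        _ = _ := by rw [hQ]; ring
  have hi : IntervalIntegrable (fun y => H y * G 0 y) volume c0 c := by
    rw [intervalIntegrable_iff_integrableOn_Ioc_of_le hcc] at hIntg ⊢
    refine Integrable.mono' (hIntg.const_mul Q) ?_ ?_
    · apply AEStronglyMeasurable.mul
      · exact (hcont.mono (fun y hy => by simp only [mem_Ioi]; linarith [hy.1])).aestronglyMeasurable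
          measurableSet_Ioc
      · have := hG.intG 0 (Nat.zero_le _) hc0 hcc hc1
        rw [intervalIntegrable_iff_integrableOn_Ioc_of_le hcc] at this
        exact this.aestronglyMeasurable
    · filter_upwards [ae_restrict_mem measurableSet_Ioc] with y hy using hbd y hy
  refine ⟨hi, ?_⟩
  have h1 : |∫ y in c0..c, H y * G 0 y| ≤ ∫ y in c0..c, Q * (y - s) ^ (lam - 1) := by
    rw [← Real.norm_eq_abs]
    exact intervalIntegral.norm_integral_le_of_norm_le hcc (Eventually.of_forall hbd)
      (hIntg.const_mul Q)
  refine h1.trans ?_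
  rw [intervalIntegral.integral_const_mul,
    intervalIntegral.integral_comp_sub_right (fun y => y ^ (lam - 1)) s,
    integral_rpow (Or.inl (by linarith))]
  simp only [sub_add_cancel]
  have e : (n : ℝ) ^ (-(1 / 2) - lam : ℝ) = (n : ℝ) ^ (-(1 / 2) : ℝ) * (1 / n : ℝ) ^ lam := by
    rw [one_div (n : ℝ), Real.inv_rpow np.le, ← Real.rpow_neg np.le, ← Real.rpow_add np]
    congr 1
  have h2 : (c - s) ^ lam ≤ (1 / n : ℝ) ^ lam := Real.rpow_le_rpow (by linarith) hcn hlam.le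
  have h3 : 0 ≤ (c0 - s) ^ lam := Real.rpow_nonneg (by linarith) _
  calc _ ≤ Q * ((1 / n : ℝ) ^ lam / lam) := by
        gcongr; linarith
    _ = _ := by rw [e, hQ]; ring

lemma osc_far {K n : ℕ} {B P M lam s c : ℝ} {G : ℕ → ℝ → ℝ} (hG : GT K n B P G) 
    (hlam : 0 < lam) (hlK : lam < K) (hM : 0 ≤ M) (hP : 0 ≤ P) (hn : 1 ≤ n)
    (H : ℕ → ℝ → ℝ) (hder : ∀ j, ∀ y, s < y → HasDerivAt (H j) (H (j + 1) y) y)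
    (hsup : ∀ j ≤ K, ∀ y, s < y → B < |y| → H j y = 0)
    (hnear : ∀ j ≤ K, ∀ y, s < y → y - s ≤ 1 → |H j y| ≤ M * (y - s) ^ (lam - 1 - j))
    (hfar : ∀ j ≤ K, ∀ y, 1 ≤ y - s → |H j y| ≤ M)
    (hc0 : -1 ≤ c) (hc1 : c ≤ 1) (hs : s < c) (hcn : 1 / n ≤ c - s)
    (hcc : c = -1 ∨ c - s = 1 / n) :
    IntervalIntegrable (fun y => H 0 y * G 0 y) volume c 1 ∧
    |∫ y in c..1, H 0 y * G 0 y| ≤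
      (K + 1 / (K - lam) + 2) * (M * (P * (n : ℝ) ^ (-(1 / 2) - lam : ℝ))) := by
  have np : (0 : ℝ) < n := by exact_mod_cast hn
  have n1 : 1 / (n : ℝ) ≤ 1 := by
    rw [div_le_one np]; exact_mod_cast hn
  have hcont : ∀ j, ContinuousOn (H j) (Icc c 1) := fun j y hy =>
    (hder j y (by linarith [hy.1])).continuousAt.continuousWithinAt
  have hi0 := hG.intG 0 (Nat.zero_le _) hc0 hc1 le_rfl
  have hiK := hG.intG K le_rfl hc0 hc1 le_rfl
  refine ⟨hi0.continuousOn_mul (by rw [uIcc_of_le hc1]; exact hcont 0), ?_⟩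
  refine (ibp hG hc0 hc1 H (fun j _ => hcont j)
    (fun j _ y hy => hder j y (by linarith [hy.1]))).trans ?_
  set R := M * (P * (n : ℝ) ^ (-(1 / 2) - lam : ℝ)) with hR
  have hR0 : 0 ≤ R := by positivity
  have hb : ∑ j ∈ Finset.range K, |H j c| * |G (j + 1) c| ≤ K * R := by
    calc _ ≤ ∑ j ∈ Finset.range K, R := by
          apply Finset.sum_le_sum
          intro j hj
          have hj' := Finset.mem_range.1 hj
          rcases hcc with h | h
          · rw [h, hG.zeroL (j + 1) (by omega) (by omega)]; simpa using hR0
          · by_cases hB : B < |c|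
            · rw [hsup j (by omega) c hs hB]; simpa using hR0
            · have h1 := hnear j (by omega) c hs (by linarith)
              have h2 := hG.sup (j + 1) (by omega) c (abs_le.1 (not_lt.1 hB))
              rw [h] at h1
              have e : (n : ℝ) ^ (-(1 / 2) - lam : ℝ) =
                  (1 / n : ℝ) ^ (lam - 1 - j) * (n : ℝ) ^ (-(1 / 2) - ((j + 1 : ℕ) : ℝ)) := by
                rw [one_div (n : ℝ), Real.inv_rpow np.le, ← Real.rpow_neg np.le,
                  ← Real.rpow_add np]
                congr 1; push_cast; ring
              calc _ ≤ (M * (1 / n : ℝ) ^ (lam - 1 - j)) *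
                    (P * (n : ℝ) ^ (-(1 / 2) - ((j + 1 : ℕ) : ℝ))) := by gcongr
                _ = R := by rw [hR, e]; ring
      _ = _ := by simp
  set Q := M * (P * (n : ℝ) ^ (-(1 / 2) - K : ℝ)) with hQ
  have hQ0 : 0 ≤ Q := by positivity
  have hKl : 0 < K - lam := by linarith
  have hcr : ContinuousOn (fun y : ℝ => (y - s) ^ (lam - 1 - K)) (Icc c 1) := by
    apply ContinuousOn.rpow_const (by fun_prop)
    intro y hy; left; linarith [hy.1]
  have hir : IntervalIntegrable (fun y : ℝ => (y - s) ^ (lam - 1 - K)) volume c 1 := by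
    apply ContinuousOn.intervalIntegrable; rw [uIcc_of_le hc1]; exact hcr
  have hK : ∫ y in c..1, |H K y * G K y| ≤ (1 / (K - lam) + 2) * R := by
    calc _ ≤ ∫ y in c..1, Q * ((y - s) ^ (lam - 1 - K) + 1) := by
          apply intervalIntegral.integral_mono_on hc1
          · exact (hiK.continuousOn_mul (by rw [uIcc_of_le hc1]; exact hcont K)).abs
          · exact (hir.add intervalIntegrable_const).const_mul Q
          · intro y hy
            have hys : s < y := by linarith [hy.1]
            have hpos : 0 ≤ (y - s) ^ (lam - 1 - K) := Real.rpow_nonneg (by linarith) _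
            by_cases hB : B < |y|
            · rw [hsup K le_rfl y hys hB]; simp; positivity
            · have h2 := hG.sup K le_rfl y (abs_le.1 (not_lt.1 hB))
              have h1 : |H K y| ≤ M * ((y - s) ^ (lam - 1 - K) + 1) := by
                rcases le_total (y - s) 1 with h | h
                · refine (hnear K le_rfl y hys h).trans ?_
                  gcongr; linarith
                · refine (hfar K le_rfl y h).trans ?_
                  nlinarith
              rw [abs_mul]
              calc |H K y| * |G K y| ≤ (M * ((y - s) ^ (lam - 1 - K) + 1)) *
                    (P * (n : ℝ) ^ (-(1 / 2) - K : ℝ)) := by gcongr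
                _ = _ := by rw [hQ]; ring
      _ = Q * ((((1 - s) ^ (lam - K) - (c - s) ^ (lam - K)) / (lam - K)) + (1 - c)) := by
          rw [intervalIntegral.integral_const_mul, intervalIntegral.integral_add hir
            intervalIntegrable_const, 
            intervalIntegral.integral_comp_sub_right (fun y => y ^ (lam - 1 - K)) s,
            integral_rpow]
          · rw [show lam - 1 - K + 1 = lam - (K : ℝ) by ring, intervalIntegral.integral_const]
            simp
          · right
            refine ⟨by linarith, ?_⟩
            rw [uIcc_of_le (by linarith)]
            intro h; linarith [h.1]
      _ ≤ Q * ((n : ℝ) ^ (K - lam) / (K - lam) + 2 * (n : ℝ) ^ (K - lam)) := by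
          have hone : 1 ≤ (n : ℝ) ^ (K - lam) :=
            Real.one_le_rpow (by exact_mod_cast hn) hKl.le
          have h1 : (c - s) ^ (lam - K) ≤ (n : ℝ) ^ (K - lam) := by
            calc (c - s) ^ (lam - K) ≤ (1 / n : ℝ) ^ (lam - K) :=
                  Real.rpow_le_rpow_of_nonpos (by positivity) hcn (by linarith)
              _ = _ := by
                  rw [one_div (n : ℝ), Real.inv_rpow np.le, ← Real.rpow_neg np.le]
                  congr 1; ring
          have h2 : 0 ≤ (1 - s) ^ (lam - K) := Real.rpow_nonneg (by linarith) _
          apply mul_le_mul_of_nonneg_left _ hQ0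
          apply add_le_add
          · rw [← neg_div_neg_eq, neg_sub, neg_sub]
            gcongr; linarith
          · linarith
      _ = (1 / (K - lam) + 2) * R := by
          have e : (n : ℝ) ^ (-(1 / 2) - lam : ℝ) =
              (n : ℝ) ^ (-(1 / 2) - K : ℝ) * (n : ℝ) ^ (K - lam) := by
            rw [← Real.rpow_add np]; congr 1; ring
          rw [hR, e, hQ]; ring
  linarith

theorem osc_decay {K n : ℕ} {B P M lam s : ℝ} {G : ℕ → ℝ → ℝ} (hG : GT K n B P G) 
    (hlam : 0 < lam) (hlK : lam < K) (hM : 0 ≤ M) (hP : 0 ≤ P) (hn : 1 ≤ n)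
    (H : ℕ → ℝ → ℝ) (hder : ∀ j, ∀ y, s < y → HasDerivAt (H j) (H (j + 1) y) y)
    (hzero : ∀ y ≤ s, H 0 y = 0)
    (hsup : ∀ j ≤ K, ∀ y, s < y → B < |y| → H j y = 0)
    (hnear : ∀ j ≤ K, ∀ y, s < y → y - s ≤ 1 → |H j y| ≤ M * (y - s) ^ (lam - 1 - j))
    (hfar : ∀ j ≤ K, ∀ y, 1 ≤ y - s → |H j y| ≤ M) :
    |∫ y in (-1 : ℝ)..1, H 0 y * G 0 y| ≤
      (1 / lam + (K + 1 / (K - lam) + 2)) * (M * (P * (n : ℝ) ^ (-(1 / 2) - lam : ℝ))) := by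
  have np : (0 : ℝ) < n := by exact_mod_cast hn
  have n0 : 0 < 1 / (n : ℝ) := by positivity
  set R := M * (P * (n : ℝ) ^ (-(1 / 2) - lam : ℝ)) with hR
  have hR0 : 0 ≤ R := by positivity
  have hKl : 0 < K - lam := by linarith
  have hz : ∀ d : ℝ, d ≤ 1 → -1 ≤ d → d ≤ max s (-1) → 
      IntervalIntegrable (fun y => H 0 y * G 0 y) volume (-1) d ∧
      ∫ y in (-1 : ℝ)..d, H 0 y * G 0 y = 0 := by
    intro d hd hd' hds
    have : EqOn (fun y => H 0 y * G 0 y) (fun _ => 0) (uIoc (-1) d) := by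
      intro y hy
      rw [uIoc_of_le hd'] at hy
      have : y ≤ s := by
        rcases le_max_iff.1 hds with h | h
        · linarith [hy.2]
        · linarith [hy.1, hy.2]
      simp [hzero y this]
    constructor
    · exact (intervalIntegrable_congr this).2 intervalIntegrable_const
    · rw [intervalIntegral.integral_congr_ae (g := fun _ => 0)]
      · simp
      · exact Eventually.of_forall this
  have hfc : 0 ≤ (K + 1 / (K - lam) + 2) := by positivity
  have hnc : 0 ≤ 1 / lam := by positivity
  have hcont : ContinuousOn (H 0) (Ioi s) := fun y hy =>
    (hder 0 y hy).continuousAt.continuousWithinAt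
  have hnear0 : ∀ y, s < y → y - s ≤ 1 → |H 0 y| ≤ M * (y - s) ^ (lam - 1) := by
    intro y h1 h2; simpa using hnear 0 (Nat.zero_le _) y h1 h2
  rcases le_total 1 s with h1s | h1s
  · rw [(hz 1 le_rfl (by norm_num) (le_max_of_le_left h1s)).2]
    simp; positivity
  rcases le_total (s + 1 / n) (-1) with h2s | h2s
  · refine (osc_far hG hlam hlK hM hP hn H hder hsup hnear hfar le_rfl (by norm_num)
      (by linarith) (by linarith) (Or.inl rfl)).2.trans ?_
    rw [add_mul]; have : 0 ≤ 1 / lam * R := by positivity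
    linarith
  have hz0 := hz (max s (-1)) (max_le h1s (by norm_num)) (le_max_right _ _) le_rfl
  have hc0c : max s (-1) ≤ min (s + 1 / n) 1 :=
    max_le (le_min (by linarith) h1s) (le_min h2s (by norm_num))
  have hnr := osc_near hG hlam hM hP hn (H 0) hcont (hsup 0 (Nat.zero_le _)) hnear0
    (le_max_right s (-1)) hc0c (min_le_right _ _) (le_max_left _ _)
    (by linarith [min_le_left (s + 1 / (n : ℝ)) 1])
  rcases le_total 1 (s + 1 / n) with h3s | h3s
  · rw [min_eq_right h3s] at hnr
    rw [← intervalIntegral.integral_add_adjacent_intervals hz0.1 hnr.1, hz0.2, zero_add]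
    refine hnr.2.trans ?_
    rw [add_mul]
    have : 0 ≤ (K + 1 / (K - lam) + 2) * R := by positivity
    linarith
  · rw [min_eq_left h3s] at hnr
    have hf := osc_far hG hlam hlK hM hP hn H hder hsup hnear hfar h2s h3s
      (by linarith) (by linarith) (Or.inr (by ring))
    rw [← intervalIntegral.integral_add_adjacent_intervals hz0.1 (hnr.1.trans hf.1), hz0.2,
      zero_add, ← intervalIntegral.integral_add_adjacent_intervals hnr.1 hf.1, add_mul]
    exact (abs_add_le _ _).trans (add_le_add hnr.2 hf.2)

open MeasureTheory Set Filter Topology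

lemma seg_mem {x y t : ℝ} (hx : x ∈ Icc (-1 : ℝ) 1) (hy : y ∈ Icc (-1 : ℝ) 1) (ht : t ∈ Icc (0 : ℝ) 1) :
    x + t * (y - x) ∈ Icc (-1 : ℝ) 1 := by
  have h1 := hx.1; have h2 := hx.2; have h3 := hy.1; have h4 := hy.2
  have h5 := ht.1; have h6 := ht.2
  constructor <;> nlinarith

lemma quot_rep {F F' : ℝ → ℝ} {S : Set ℝ} (hS : S.Countable) (hc : ContinuousOn F (Icc (-1) 1))
    (hd : ∀ u ∈ Ioo (-1 : ℝ) 1 \ S, HasDerivAt F (F' u) u)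
    (hi : IntervalIntegrable F' volume (-1) 1) {x y : ℝ} (hx : x ∈ Icc (-1 : ℝ) 1)
    (hy : y ∈ Icc (-1 : ℝ) 1) (hxy : y ≠ x) :
    (F x - F y) / (x - y) = ∫ t in (0 : ℝ)..1, F' (x + t * (y - x)) := by
  have hsub : uIcc x y ⊆ Icc (-1) 1 := (convex_Icc (-1 : ℝ) 1).ordConnected.uIcc_subset hx hy
  have h1 : ∫ u in x..y, F' u = F y - F x := by
    apply integral_eq_of_hasDerivAt_off_countable F F' hS (hc.mono hsub)
    · intro u hu
      apply hd u
      refine ⟨⟨?_, ?_⟩, hu.2⟩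
      · exact lt_of_le_of_lt (le_min hx.1 hy.1) hu.1.1
      · exact lt_of_lt_of_le hu.1.2 (max_le hx.2 hy.2)
    · apply hi.mono_set
      rwa [uIcc_of_le (by norm_num : (-1 : ℝ) ≤ 1)]
  have hne : y - x ≠ 0 := sub_ne_zero.2 hxy
  have h2 := intervalIntegral.integral_comp_add_mul (a := 0) (b := 1) F' hne x
  have h3 : ∫ t in (0 : ℝ)..1, F' (x + t * (y - x)) = ∫ t in (0 : ℝ)..1, F' (x + (y - x) * t) := by
    congr 1; funext t; rw [mul_comm]
  rw [h3, h2]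
  simp only [mul_zero, add_zero, mul_one, add_sub_cancel, smul_eq_mul]
  rw [h1]
  have hne' : x - y ≠ 0 := sub_ne_zero.2 hxy.symm
  field_simp
  ring

lemma fubini_quot {F F' w m : ℝ → ℝ} {x : ℝ}
    (hrep : ∀ y ∈ Icc (-1 : ℝ) 1, y ≠ x →
      (F x - F y) / (x - y) = ∫ t in (0 : ℝ)..1, F' (x + t * (y - x)))
    (hIntg : Integrable (fun p : ℝ × ℝ => F' (x + p.1 * (p.2 - x)) * w p.2)
      ((volume.restrict (Ioc (0 : ℝ) 1)).prod (volume.restrict (Ioc (-1 : ℝ) 1))))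
    (hm : IntervalIntegrable m volume 0 1)
    (hb : ∀ t ∈ Ioc (0 : ℝ) 1, |∫ y in (-1 : ℝ)..1, F' (x + t * (y - x)) * w y| ≤ m t) :
    IntervalIntegrable (fun y => (F x - F y) / (x - y) * w y) volume (-1) 1 ∧
    |∫ y in (-1 : ℝ)..1, (F x - F y) / (x - y) * w y| ≤ ∫ t in (0 : ℝ)..1, m t := by
  have hae : (fun y => (F x - F y) / (x - y) * w y) =ᵐ[volume.restrict (Ioc (-1 : ℝ) 1)]
      fun y => ∫ t in Ioc (0 : ℝ) 1, F' (x + t * (y - x)) * w y := by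
    have hx : ∀ᵐ y ∂(volume.restrict (Ioc (-1 : ℝ) 1)), y ≠ x :=
      ae_restrict_of_ae (Measure.ae_ne volume x)
    filter_upwards [ae_restrict_mem measurableSet_Ioc, hx] with y hy hyx
    rw [hrep y ⟨hy.1.le, hy.2⟩ hyx, intervalIntegral.integral_of_le zero_le_one,
      integral_mul_const]
  have h1 : Integrable (fun y => ∫ t in Ioc (0 : ℝ) 1, F' (x + t * (y - x)) * w y)
      (volume.restrict (Ioc (-1 : ℝ) 1)) := hIntg.integral_prod_right
  refine ⟨?_, ?_⟩
  · rw [intervalIntegrable_iff_integrableOn_Ioc_of_le (by norm_num)]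
    exact h1.congr hae.symm
  · rw [intervalIntegral.integral_of_le (by norm_num : (-1 : ℝ) ≤ 1), integral_congr_ae hae,
      ← integral_integral_swap (f := fun t y => F' (x + t * (y - x)) * w y) hIntg,
      ← intervalIntegral.integral_of_le zero_le_one, ← Real.norm_eq_abs]
    apply intervalIntegral.norm_integral_le_of_norm_le zero_le_one _ hm
    apply Eventually.of_forall
    intro t ht
    rw [Real.norm_eq_abs, ← intervalIntegral.integral_of_le (by norm_num : (-1 : ℝ) ≤ 1)]
    exact hb t ht

theorem smooth_part (F : ℕ → ℝ → ℝ) (hc : ∀ j, ContinuousOn (F j) (Icc (-1) 1))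
    (hd : ∀ j, ∀ y ∈ Ioo (-1 : ℝ) 1, HasDerivAt (F j) (F (j + 1) y) y) (K : ℕ) :
    ∃ C : ℝ, 0 < C ∧ ∀ (n : ℕ) (B P : ℝ) (G : ℕ → ℝ → ℝ), GT K n B P G →
      ∀ x ∈ Icc (-1 : ℝ) 1,
      IntervalIntegrable (fun y => (F 0 x - F 0 y) / (x - y) * G 0 y) volume (-1) 1 ∧
      |∫ y in (-1 : ℝ)..1, (F 0 x - F 0 y) / (x - y) * G 0 y| ≤
        C * (P * (n : ℝ) ^ (-(1 / 2) - K : ℝ)) := by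
  obtain ⟨M, hM⟩ := isCompact_Icc.exists_bound_of_continuousOn (hc (K + 1))
  obtain ⟨M1, hM1⟩ := isCompact_Icc.exists_bound_of_continuousOn (hc 1)
  have hM0 : 0 ≤ M := (norm_nonneg _).trans (hM 0 (by simp))
  refine ⟨M + 1, by positivity, fun n B P G hG x hx => ?_⟩
  have hi1 : IntervalIntegrable (F 1) volume (-1) 1 := by
    apply ContinuousOn.intervalIntegrable; rw [uIcc_of_le (by norm_num)]; exact hc 1
  have hbase := fubini_quot (F := F 0) (F' := F 1) (w := G 0)
    (m := fun _ => (M + 1) * (P * (n : ℝ) ^ (-(1 / 2) - K : ℝ))) (x := x)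
    (fun y hy hyx => quot_rep countable_empty (hc 0) (fun u hu => hd 0 u hu.1) hi1 hx hy hyx)
    ?_ intervalIntegrable_const ?_
  · simpa using hbase
  · have hGi := hG.int0
    rw [intervalIntegrable_iff_integrableOn_Ioc_of_le (by norm_num)] at hGi
    have h2 : Integrable (fun p : ℝ × ℝ => G 0 p.2)
      ((volume.restrict (Ioc (0 : ℝ) 1)).prod (volume.restrict (Ioc (-1 : ℝ) 1))) :=
      Integrable.comp_snd hGi _
    refine Integrable.bdd_mul (c := M1) h2 ?_ ?_
    · rw [Measure.prod_restrict]
      apply ContinuousOn.aestronglyMeasurable _ (measurableSet_Ioc.prod measurableSet_Ioc)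
      apply (hc 1).comp (by fun_prop)
      intro p hp
      exact seg_mem hx (Ioc_subset_Icc_self hp.2) (Ioc_subset_Icc_self hp.1)
    · rw [Measure.prod_restrict]
      filter_upwards [ae_restrict_mem (measurableSet_Ioc.prod measurableSet_Ioc)] with p hp
      exact hM1 _ (seg_mem hx (Ioc_subset_Icc_self hp.2) (Ioc_subset_Icc_self hp.1))
  · intro t ht
    have ht' := Ioc_subset_Icc_self ht
    have := smooth_decay (M := M + 1) hG (fun j y => t ^ j * F (j + 1) (x + t * (y - x))) ?_ ?_ ?_
    · simpa using this
    · intro j _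
      apply continuousOn_const.mul
      apply (hc (j + 1)).comp (by fun_prop)
      intro y hy
      exact seg_mem hx hy ht'
    · intro j _ y hy
      have hm : x + t * (y - x) ∈ Ioo (-1 : ℝ) 1 := by
        have h1 := hx.1; have h2 := hx.2; have h3 := hy.1; have h4 := hy.2
        have h5 := ht.1; have h6 := ht.2
        constructor <;> nlinarith
      have hin : HasDerivAt (fun y : ℝ => x + t * (y - x)) t y := by
        refine HasDerivAt.congr_deriv ((((hasDerivAt_id y).sub_const x).const_mul t).const_add x) ?_
        simp
      refine HasDerivAt.congr_deriv (((hd (j + 1) _ hm).comp y hin).const_mul (t ^ j)) ?_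
      ring
    · intro y hy
      have h := hM _ (seg_mem hx hy ht')
      rw [Real.norm_eq_abs] at h
      rw [abs_mul, abs_pow, abs_of_nonneg ht'.1]
      calc _ ≤ 1 * M := by
            gcongr
            exact pow_le_one₀ ht'.1 ht'.2
        _ ≤ _ := by linarith

open MeasureTheory Set Filter Topology
open scoped ContDiff

/-- product tower -/
noncomputable def prodTow (A E : ℕ → ℝ → ℝ) (j : ℕ) (y : ℝ) : ℝ :=
  ∑ p ∈ Finset.HasAntidiagonal.antidiagonal j, (j.choose p.1 : ℝ) * (A p.1 y * E p.2 y)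

lemma prodTow_der {A E : ℕ → ℝ → ℝ} {y : ℝ} (hA : ∀ j, HasDerivAt (A j) (A (j + 1) y) y)
    (hE : ∀ j, HasDerivAt (E j) (E (j + 1) y) y) (j : ℕ) :
    HasDerivAt (prodTow A E j) (prodTow A E (j + 1) y) y := by
  have h : HasDerivAt (prodTow A E j) (∑ p ∈ Finset.HasAntidiagonal.antidiagonal j,
      (j.choose p.1 : ℝ) * (A (p.1 + 1) y * E p.2 y + A p.1 y * E (p.2 + 1) y)) y := by
    unfold prodTow
    apply HasDerivAt.fun_sum
    intro p _
    exact ((hA p.1).mul (hE p.2)).const_mul _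
  refine h.congr_deriv ?_
  unfold prodTow
  rw [Finset.sum_antidiagonal_choose_succ_mul (fun i l => A i y * E l y) j,
    ← Finset.sum_add_distrib]
  apply Finset.sum_congr rfl
  intro p hp
  have hp' := Finset.HasAntidiagonal.mem_antidiagonal.1 hp
  have : j.choose p.2 = j.choose p.1 := by
    rw [← hp']; exact (Nat.choose_symm_add).symm
  rw [this]; ring

lemma prodTow_bound {A E : ℕ → ℝ → ℝ} {y u v : ℝ} {j K : ℕ} (hj : j ≤ K) (hu : 0 ≤ u) (hv : 0 ≤ v)
    (hA : ∀ i ≤ j, |A i y| ≤ u) (hE : ∀ i ≤ j, |E i y| ≤ v) :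
    |prodTow A E j y| ≤ (K + 1) * 2 ^ K * (u * v) := by
  unfold prodTow
  refine (Finset.abs_sum_le_sum_abs _ _).trans ?_
  calc _ ≤ ∑ p ∈ Finset.HasAntidiagonal.antidiagonal j, (2 : ℝ) ^ K * (u * v) := by
        apply Finset.sum_le_sum
        intro p hp
        have hp' := Finset.HasAntidiagonal.mem_antidiagonal.1 hp
        rw [abs_mul, abs_mul, Nat.abs_cast]
        have h1 : (j.choose p.1 : ℝ) ≤ 2 ^ K := by
          calc (j.choose p.1 : ℝ) ≤ 2 ^ j := by exact_mod_cast Nat.choose_le_two_pow j p.1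
            _ ≤ _ := pow_le_pow_right₀ (by norm_num) hj
        gcongr
        · exact hA _ (by omega)
        · exact hE _ (by omega)
    _ = (j + 1) * (2 ^ K * (u * v)) := by simp
    _ ≤ _ := by
        have : (j : ℝ) ≤ K := by exact_mod_cast hj
        have h2 : 0 ≤ (2 : ℝ) ^ K * (u * v) := by positivity
        nlinarith

/-- smooth factors of the derivatives -/
noncomputable def psi (a lam : ℝ) (ζ : ℝ → ℝ) : ℕ → ℝ → ℝ
  | 0 => fun u => lam * ζ u + (u - a) * deriv ζ u
  | j + 1 => fun u => (lam - 1 - j) * psi a lam ζ j u + (u - a) * deriv (psi a lam ζ j) u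

lemma psi_contDiff (a lam : ℝ) {ζ : ℝ → ℝ} (hζ : ContDiff ℝ ∞ ζ) (j : ℕ) :
    ContDiff ℝ ∞ (psi a lam ζ j) := by
  induction j with
  | zero =>
    have : ContDiff ℝ ∞ (deriv ζ) := (contDiff_infty_iff_deriv.1 hζ).2
    unfold psi; fun_prop
  | succ j ih =>
    have : ContDiff ℝ ∞ (deriv (psi a lam ζ j)) := (contDiff_infty_iff_deriv.1 ih).2
    unfold psi; fun_prop

noncomputable def phF (a lam : ℝ) (ζ : ℝ → ℝ) (u : ℝ) : ℝ :=
  if a < u then (u - a) ^ lam * ζ u else 0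

noncomputable def phD (a lam : ℝ) (ζ : ℝ → ℝ) (j : ℕ) (u : ℝ) : ℝ :=
  if a < u then (u - a) ^ (lam - 1 - j) * psi a lam ζ j u else 0

lemma rpow_mul_der (a r : ℝ) {h : ℝ → ℝ} {h' u : ℝ} (hh : HasDerivAt h h' u) (hu : a < u) :
    HasDerivAt (fun u => (u - a) ^ r * h u) ((u - a) ^ (r - 1) * (r * h u + (u - a) * h')) u := by
  have hp : 0 < u - a := by linarith
  have h1 : HasDerivAt (fun u : ℝ => (u - a) ^ r) (1 * r * (u - a) ^ (r - 1)) u :=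
    ((hasDerivAt_id u).sub_const a).rpow_const (Or.inl hp.ne')
  refine HasDerivAt.congr_deriv (h1.mul hh) ?_
  have : (u - a) ^ r = (u - a) ^ (r - 1) * (u - a) := by
    rw [← Real.rpow_add_one hp.ne']; congr 1; ring
  rw [this]; ring

lemma phF_der (a lam : ℝ) {ζ : ℝ → ℝ} (hζ : ContDiff ℝ ∞ ζ) {u : ℝ} (hu : u ≠ a) :
    HasDerivAt (phF a lam ζ) (phD a lam ζ 0 u) u := by
  rcases lt_or_gt_of_ne hu with h | h
  · have e : phF a lam ζ =ᶠ[𝓝 u] fun _ => 0 := by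
      filter_upwards [Iio_mem_nhds h] with v hv
      have hv : v < a := hv
      simp [phF, not_lt.2 (le_of_lt hv)]
    have : phD a lam ζ 0 u = 0 := by simp [phD, not_lt.2 h.le]
    rw [this]
    exact (hasDerivAt_const u (0 : ℝ)).congr_of_eventuallyEq e
  · have e : phF a lam ζ =ᶠ[𝓝 u] fun u => (u - a) ^ lam * ζ u := by
      filter_upwards [Ioi_mem_nhds h] with v hv
      have hv : a < v := hv
      simp only [phF]; rw [if_pos hv]
    have hd := rpow_mul_der a lam
      ((hζ.differentiable (by simp)) u).hasDerivAt h
    refine (hd.congr_of_eventuallyEq e).congr_deriv ?_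
    simp only [phD, psi]; rw [if_pos h]; simp

lemma phD_der (a lam : ℝ) {ζ : ℝ → ℝ} (hζ : ContDiff ℝ ∞ ζ) (j : ℕ) {u : ℝ} (h : a < u) :
    HasDerivAt (phD a lam ζ j) (phD a lam ζ (j + 1) u) u := by
  have e : phD a lam ζ j =ᶠ[𝓝 u] fun u => (u - a) ^ (lam - 1 - j) * psi a lam ζ j u := by
    filter_upwards [Ioi_mem_nhds h] with v hv
    have hv : a < v := hv
    simp only [phD]; rw [if_pos hv]
  have hd := rpow_mul_der a (lam - 1 - j)
    (((psi_contDiff a lam hζ j).differentiable (by simp)) u).hasDerivAt h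
  refine (hd.congr_of_eventuallyEq e).congr_deriv ?_
  simp only [phD, psi]; rw [if_pos h]
  congr 2
  push_cast; ring

lemma phF_cont (a lam : ℝ) (hlam : 0 < lam) {ζ : ℝ → ℝ} (hζ : ContDiff ℝ ∞ ζ) :
    Continuous (phF a lam ζ) := by
  have : phF a lam ζ = fun u => (max (u - a) 0) ^ lam * ζ u := by
    funext u
    unfold phF
    split_ifs with h
    · rw [max_eq_left (by linarith)]
    · rw [max_eq_right (by linarith), Real.zero_rpow hlam.ne', zero_mul]
  rw [this]
  apply Continuous.mul _ hζ.continuous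
  exact Continuous.rpow_const (by fun_prop) (fun _ => Or.inr hlam.le)

lemma phD_measurable (a lam : ℝ) {ζ : ℝ → ℝ} (hζ : ContDiff ℝ ∞ ζ) (j : ℕ) :
    Measurable (phD a lam ζ j) := by
  apply Measurable.ite measurableSet_Ioi
  · have := (psi_contDiff a lam hζ j).continuous.measurable
    fun_prop
  · fun_prop

lemma phD_integrable (a lam : ℝ) (hlam : 0 < lam) {ζ : ℝ → ℝ} (hζ : ContDiff ℝ ∞ ζ) (c d : ℝ) :
    IntervalIntegrable (phD a lam ζ 0) volume c d := by
  have h1 := (rpow_sub_integrable (lam - 1) a c d (by linarith)).mul_continuousOn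
    (psi_contDiff a lam hζ 0).continuous.continuousOn
  refine h1.mono_fun (phD_measurable a lam hζ 0).aestronglyMeasurable ?_
  apply Eventually.of_forall
  intro u
  simp only [phD]
  split_ifs
  · simp
  · simp; positivity

open MeasureTheory Set Filter Topology
open scoped ContDiff

lemma iterD_der {η : ℝ → ℝ} (hη : ContDiff ℝ ∞ η) (j : ℕ) (y : ℝ) :
    HasDerivAt (iteratedDeriv j η) (iteratedDeriv (j + 1) η y) y := by
  rw [iteratedDeriv_succ]
  exact ((hη.differentiable_iteratedDeriv j (by exact_mod_cast WithTop.coe_lt_top _)) y).hasDerivAt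

lemma iterD_cont {η : ℝ → ℝ} (hη : ContDiff ℝ ∞ η) (j : ℕ) : Continuous (iteratedDeriv j η) := by
  apply continuous_iff_continuousAt.2
  intro y
  exact (iterD_der hη j y).continuousAt

lemma iterD_zero {η : ℝ → ℝ} {B : ℝ} (hB : ∀ y, B < |y| → η y = 0) (j : ℕ) {y : ℝ} (hy : B < |y|) :
    iteratedDeriv j η y = 0 := by
  have e : η =ᶠ[𝓝 y] fun _ => 0 := by
    have : {y : ℝ | B < |y|} ∈ 𝓝 y := (isOpen_lt continuous_const continuous_abs).mem_nhds hy
    filter_upwards [this] with v hv using hB v hv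
  rw [e.iteratedDeriv_eq j]
  simp

lemma exists_unif_bound (E : ℕ → ℝ → ℝ) (hE : ∀ j, Continuous (E j)) (K : ℕ) :
    ∃ M : ℝ, 0 ≤ M ∧ ∀ j ≤ K, ∀ y ∈ Icc (-1 : ℝ) 1, |E j y| ≤ M := by
  have : ∀ j, ∃ M : ℝ, ∀ y ∈ Icc (-1 : ℝ) 1, ‖E j y‖ ≤ M := fun j =>
    isCompact_Icc.exists_bound_of_continuousOn (hE j).continuousOn
  choose M hM using this
  have hM0 : ∀ j, 0 ≤ M j := fun j => (norm_nonneg _).trans (hM j 0 (by simp))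
  refine ⟨∑ j ∈ Finset.range (K + 1), M j, Finset.sum_nonneg (fun j _ => hM0 j), ?_⟩
  intro j hj y hy
  exact (hM j y hy).trans
    (Finset.single_le_sum (f := M) (fun i _ => hM0 i) (Finset.mem_range.2 (by omega)))

lemma rpow_between {t v b r : ℝ} (ht : 0 < t) (htv : t ≤ v) (hvb : v ≤ b) :
    v ^ r ≤ t ^ r + b ^ r := by
  have h1 : 0 ≤ t ^ r := Real.rpow_nonneg ht.le _
  have h2 : 0 ≤ b ^ r := Real.rpow_nonneg (by linarith) _
  rcases le_total 0 r with h | h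
  · have := Real.rpow_le_rpow (by linarith) hvb h; linarith
  · have := Real.rpow_le_rpow_of_nonpos ht htv h; linarith

/-- the tower in `y` -/
noncomputable def oscT (a lam : ℝ) (ζ η : ℝ → ℝ) (x t : ℝ) : ℕ → ℝ → ℝ :=
  prodTow (fun j y => t ^ j * phD a lam ζ j (x + t * (y - x))) (fun j => iteratedDeriv j η)

lemma oscT_zero (a lam : ℝ) (ζ η : ℝ → ℝ) (x t y : ℝ) :
    oscT a lam ζ η x t 0 y = phD a lam ζ 0 (x + t * (y - x)) * η y := by
  simp [oscT, prodTow]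

lemma oscT_props {a lam B : ℝ} {ζ η : ℝ → ℝ} (ha : a ∈ Ioo (-1 : ℝ) 1) (hB : B ≤ 1)
    (hζ : ContDiff ℝ ∞ ζ) (hη : ContDiff ℝ ∞ η) (hηB : ∀ y, B < |y| → η y = 0) (K : ℕ) :
    ∃ C : ℝ, 0 ≤ C ∧ ∀ x ∈ Icc (-1 : ℝ) 1, ∀ t ∈ Ioc (0 : ℝ) 1, ∀ s, s = x + (a - x) / t →
      (∀ j, ∀ y, s < y → HasDerivAt (oscT a lam ζ η x t j) (oscT a lam ζ η x t (j + 1) y) y) ∧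
      (∀ y ≤ s, oscT a lam ζ η x t 0 y = 0) ∧
      (∀ j ≤ K, ∀ y, s < y → B < |y| → oscT a lam ζ η x t j y = 0) ∧
      (∀ j ≤ K, ∀ y, s < y → y - s ≤ 1 → |oscT a lam ζ η x t j y| ≤
        (C * (t ^ (lam - 1) + 2 ^ (lam - 1))) * (y - s) ^ (lam - 1 - j)) ∧
      (∀ j ≤ K, ∀ y, 1 ≤ y - s → |oscT a lam ζ η x t j y| ≤
        (C * (t ^ (lam - 1) + 2 ^ (lam - 1)))) := by
  obtain ⟨M1, hM1, h1⟩ := exists_unif_bound _ (fun j => (psi_contDiff a lam hζ j).continuous) K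
  obtain ⟨M2, hM2, h2⟩ := exists_unif_bound _ (fun j => iterD_cont hη j) K
  refine ⟨(K + 1) * 2 ^ K * (M1 * M2), by positivity, ?_⟩
  intro x hx t ht s hs
  have ht0 := ht.1
  have key : ∀ y, x + t * (y - x) - a = t * (y - s) := by
    intro y; rw [hs]; field_simp; ring
  have hlt : ∀ y, s < y ↔ a < x + t * (y - x) := by
    intro y
    have := key y
    constructor
    · intro h
      have : 0 < t * (y - s) := mul_pos ht0 (by linarith)
      linarith
    · intro h
      have : 0 < t * (y - s) := by linarith
      have := (mul_pos_iff_of_pos_left ht0).1 this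
      linarith
  have hp1 : 0 < t ^ (lam - 1) := Real.rpow_pos_of_pos ht0 _
  have hp2 : 0 < (2 : ℝ) ^ (lam - 1) := Real.rpow_pos_of_pos (by norm_num) _
  have hsup : ∀ j, ∀ y, B < |y| → oscT a lam ζ η x t j y = 0 := by
    intro j y hy
    unfold oscT prodTow
    apply Finset.sum_eq_zero
    intro p _
    simp [iterD_zero hηB p.2 hy]
  refine ⟨?_, ?_, fun j _ y _ hy => hsup j y hy, ?_, ?_⟩
  · intro j y hy
    apply prodTow_der
    · intro j
      have hin : HasDerivAt (fun y : ℝ => x + t * (y - x)) t y := by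
        refine HasDerivAt.congr_deriv ((((hasDerivAt_id y).sub_const x).const_mul t).const_add x) ?_
        simp
      refine HasDerivAt.congr_deriv
        (((phD_der a lam hζ j ((hlt y).1 hy)).comp y hin).const_mul (t ^ j)) ?_
      ring
    · intro j; exact iterD_der hη j y
  · intro y hy
    rw [oscT_zero, phD, if_neg (by rw [← hlt]; exact not_lt.2 hy), zero_mul]
  · intro j hj y hy hy1
    have hys : 0 < y - s := by linarith
    have hpp : 0 < (y - s) ^ (lam - 1 - j) := Real.rpow_pos_of_pos hys _
    by_cases hBy : B < |y|
    · rw [hsup j y hBy, abs_zero]; positivity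
    have hyI : y ∈ Icc (-1 : ℝ) 1 := abs_le.1 ((not_lt.1 hBy).trans hB)
    have hu := seg_mem hx hyI (Ioc_subset_Icc_self ht)
    have := prodTow_bound (A := fun j y => t ^ j * phD a lam ζ j (x + t * (y - x)))
      (E := fun j => iteratedDeriv j η) (y := y) (u := t ^ (lam - 1) * (y - s) ^ (lam - 1 - j) * M1)
      (v := M2) hj (by positivity) hM2 ?_ (fun i hi => h2 i (by omega) y hyI)
    · refine this.trans ?_
      calc _ = ((K + 1) * 2 ^ K * (M1 * M2)) * (t ^ (lam - 1) * (y - s) ^ (lam - 1 - j)) := by ring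
        _ ≤ ((K + 1) * 2 ^ K * (M1 * M2)) *
            ((t ^ (lam - 1) + 2 ^ (lam - 1)) * (y - s) ^ (lam - 1 - j)) := by
            gcongr; linarith
        _ = _ := by ring
    · intro i hi
      have e : t ^ i * phD a lam ζ i (x + t * (y - x)) =
          t ^ (lam - 1) * (y - s) ^ (lam - 1 - i) * psi a lam ζ i (x + t * (y - x)) := by
        rw [phD, if_pos ((hlt y).1 hy), key, Real.mul_rpow ht0.le hys.le,
          show t ^ (lam - 1) = t ^ i * t ^ (lam - 1 - i) by
            rw [← Real.rpow_natCast t i, ← Real.rpow_add ht0]; congr 1; ring]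
        ring
      rw [e, abs_mul, abs_of_nonneg (by positivity)]
      gcongr ?_ * ?_ * ?_
      · apply Real.rpow_le_rpow_of_exponent_ge hys hy1
        have : (i : ℝ) ≤ j := by exact_mod_cast hi
        linarith
      · exact h1 i (by omega) _ hu
  · intro j hj y hy1
    have hys : 0 < y - s := by linarith
    have hy : s < y := by linarith
    by_cases hBy : B < |y|
    · rw [hsup j y hBy, abs_zero]; positivity
    have hyI : y ∈ Icc (-1 : ℝ) 1 := abs_le.1 ((not_lt.1 hBy).trans hB)
    have hu := seg_mem hx hyI (Ioc_subset_Icc_self ht)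
    have := prodTow_bound (A := fun j y => t ^ j * phD a lam ζ j (x + t * (y - x)))
      (E := fun j => iteratedDeriv j η) (y := y) (u := (t ^ (lam - 1) + 2 ^ (lam - 1)) * M1)
      (v := M2) hj (by positivity) hM2 ?_ (fun i hi => h2 i (by omega) y hyI)
    · refine this.trans (le_of_eq (by ring))
    · intro i hi
      set v := t * (y - s) with hv
      have hv0 : 0 < v := by positivity
      have e : t ^ i * phD a lam ζ i (x + t * (y - x)) =
          ((y - s) ^ i)⁻¹ * v ^ (lam - 1) * psi a lam ζ i (x + t * (y - x)) := by
        rw [phD, if_pos ((hlt y).1 hy), key, Real.rpow_sub hv0, Real.rpow_natCast, hv, mul_pow]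
        field_simp
      rw [e, abs_mul, abs_of_nonneg (by positivity)]
      have h3 : v ^ (lam - 1) ≤ t ^ (lam - 1) + 2 ^ (lam - 1) := by
        apply rpow_between ht0
        · rw [hv]; nlinarith
        · have := key y; have := hu.2; have := ha.1; linarith
      have h4 : ((y - s) ^ i)⁻¹ ≤ 1 := inv_le_one_of_one_le₀ (one_le_pow₀ hy1)
      calc _ ≤ (1 * (t ^ (lam - 1) + 2 ^ (lam - 1))) * M1 := by
            gcongr
            exact h1 i (by omega) _ hu
        _ = _ := by ring

open MeasureTheory Set Filter Topology
open scoped ContDiff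

/-- dominating kernel -/
noncomputable def kap (lam : ℝ) (v : ℝ) : ℝ := (Ioc (0 : ℝ) 1).indicator (fun v => v ^ (lam - 1)) v

lemma kap_integrable {lam : ℝ} (hlam : 0 < lam) : Integrable (kap lam) := by
  have h := intervalIntegral.intervalIntegrable_rpow' (a := 0) (b := 1) (r := lam - 1) (by linarith)
  rw [intervalIntegrable_iff_integrableOn_Ioc_of_le zero_le_one] at h
  exact h.integrable_indicator measurableSet_Ioc

lemma kap_nonneg (lam v : ℝ) : 0 ≤ kap lam v := by
  apply indicator_nonneg
  intro v hv
  exact Real.rpow_nonneg hv.1.le _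

theorem osc_part {a lam B : ℝ} {ζ η : ℝ → ℝ} (ha : a ∈ Ioo (-1 : ℝ) 1) (hB : B ≤ 1)
    (hlam : 0 < lam) (hζ : ContDiff ℝ ∞ ζ) (hη : ContDiff ℝ ∞ η)
    (hηB : ∀ y, B < |y| → η y = 0) (K : ℕ) (hlK : lam < K) :
    ∃ C : ℝ, 0 < C ∧ ∀ (n : ℕ) (P : ℝ) (G : ℕ → ℝ → ℝ), 1 ≤ n → 0 ≤ P → GT K n B P G →
      ∀ x ∈ Icc (-1 : ℝ) 1,
      IntervalIntegrable (fun y => (phF a lam ζ x - phF a lam ζ y) / (x - y) * (η y * G 0 y))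
        volume (-1) 1 ∧
      |∫ y in (-1 : ℝ)..1, (phF a lam ζ x - phF a lam ζ y) / (x - y) * (η y * G 0 y)| ≤
        C * (P * (n : ℝ) ^ (-(1 / 2) - lam : ℝ)) := by
  obtain ⟨C, hC, hT⟩ := oscT_props (lam := lam) ha hB hζ hη hηB K
  set D := 1 / lam + (K + 1 / (K - lam) + 2) with hD
  have hKl : 0 < K - lam := by linarith
  have hD0 : 0 < D := by positivity
  have hIm : IntervalIntegrable (fun t : ℝ => t ^ (lam - 1) + (2 : ℝ) ^ (lam - 1)) volume 0 1 :=
    (intervalIntegral.intervalIntegrable_rpow' (by linarith)).add intervalIntegrable_const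
  set I := ∫ t in (0 : ℝ)..1, (t ^ (lam - 1) + (2 : ℝ) ^ (lam - 1)) with hI
  have hI0 : 0 ≤ I := by
    apply intervalIntegral.integral_nonneg zero_le_one
    intro t ht
    exact add_nonneg (Real.rpow_nonneg ht.1 _) (Real.rpow_nonneg (by norm_num) _)
  refine ⟨D * C * I + 1, by positivity, fun n P G hn hP hG x hx => ?_⟩
  set R := P * (n : ℝ) ^ (-(1 / 2) - lam : ℝ) with hR
  have hR0 : 0 ≤ R := by positivity
  have hp : ∀ t ∈ Ioc (0 : ℝ) 1, 0 ≤ C * (t ^ (lam - 1) + 2 ^ (lam - 1)) := by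
    intro t ht
    exact mul_nonneg hC (add_nonneg (Real.rpow_nonneg ht.1.le _) (Real.rpow_nonneg (by norm_num) _))
  have hbase := fubini_quot (F := phF a lam ζ) (F' := phD a lam ζ 0) (w := fun y => η y * G 0 y)
    (m := fun t => D * C * R * (t ^ (lam - 1) + (2 : ℝ) ^ (lam - 1))) (x := x)
    (fun y hy hyx => quot_rep (countable_singleton a) (phF_cont a lam hlam hζ).continuousOn
      (fun u hu => phF_der a lam hζ hu.2) (phD_integrable a lam hlam hζ _ _) hx hy hyx)
    ?_ (hIm.const_mul _) ?_
  · refine ⟨hbase.1, hbase.2.trans ?_⟩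
    rw [intervalIntegral.integral_const_mul]
    have : D * C * R * I = D * C * I * R := by ring
    rw [← hI, this]; nlinarith
  · set W := P * (n : ℝ) ^ (-(1 / 2) : ℝ) with hW
    have hW0 : 0 ≤ W := by positivity
    have hbd : ∀ t ∈ Ioc (0 : ℝ) 1, ∀ y, ‖phD a lam ζ 0 (x + t * (y - x)) * (η y * G 0 y)‖ ≤
        W * (C * (t ^ (lam - 1) + 2 ^ (lam - 1))) * (kap lam (y - (x + (a - x) / t)) + 1) := by
      intro t ht y
      set s := x + (a - x) / t with hs
      obtain ⟨-, hz, hs1, hs2, hs3⟩ := hT x hx t ht s hs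
      have hk := kap_nonneg lam (y - s)
      have hp' := hp t ht
      rw [← mul_assoc, ← oscT_zero, norm_mul]
      by_cases hB' : B < |y|
      · have : oscT a lam ζ η x t 0 y = 0 := by rw [oscT_zero, hηB y hB', mul_zero]
        rw [this]; simp; positivity
      have hGy := hG.sup 0 (Nat.zero_le _) y (abs_le.1 (not_lt.1 hB'))
      simp only [Nat.cast_zero, sub_zero] at hGy
      have h1 : ‖oscT a lam ζ η x t 0 y‖ ≤
          C * (t ^ (lam - 1) + 2 ^ (lam - 1)) * (kap lam (y - s) + 1) := by
        rw [Real.norm_eq_abs]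
        rcases le_or_gt y s with h | h
        · rw [hz y h, abs_zero]; positivity
        rcases le_total (y - s) 1 with h' | h'
        · refine (hs2 0 (Nat.zero_le _) y h h').trans ?_
          have : kap lam (y - s) = (y - s) ^ (lam - 1) := by
            apply indicator_of_mem; exact ⟨by linarith, h'⟩
          rw [this]; simp only [Nat.cast_zero, sub_zero]
          gcongr; linarith
        · refine (hs3 0 (Nat.zero_le _) y h').trans ?_
          nlinarith
      calc _ ≤ (C * (t ^ (lam - 1) + 2 ^ (lam - 1)) * (kap lam (y - s) + 1)) * W := by
            rw [Real.norm_eq_abs (G 0 y)]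
            gcongr
        _ = _ := by ring
    have hGi := hG.int0
    rw [intervalIntegrable_iff_integrableOn_Ioc_of_le (by norm_num)] at hGi
    have hGm : AEStronglyMeasurable (fun y => η y * G 0 y) (volume.restrict (Ioc (-1 : ℝ) 1)) :=
      hη.continuous.aestronglyMeasurable.mul hGi.aestronglyMeasurable
    have hmeas : AEStronglyMeasurable
        (fun p : ℝ × ℝ => phD a lam ζ 0 (x + p.1 * (p.2 - x)) * (η p.2 * G 0 p.2))
        ((volume.restrict (Ioc (0 : ℝ) 1)).prod (volume.restrict (Ioc (-1 : ℝ) 1))) := by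
      apply AEStronglyMeasurable.mul
      · apply Measurable.aestronglyMeasurable
        apply (phD_measurable a lam hζ 0).comp
        fun_prop
      · exact hGm.comp_snd
    have hki : ∀ s : ℝ, Integrable (fun y => kap lam (y - s) + 1)
        (volume.restrict (Ioc (-1 : ℝ) 1)) := by
      intro s
      apply Integrable.add
      · exact ((kap_integrable hlam).comp_sub_right s).integrableOn
      · exact integrable_const _
    have hkb : ∀ s : ℝ, ∫ y in Ioc (-1 : ℝ) 1, (kap lam (y - s) + 1) ≤ (∫ v, kap lam v) + 2 := by
      intro s
      have hi := (kap_integrable hlam).comp_sub_right s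
      rw [integral_add hi.integrableOn (integrable_const _)]
      apply add_le_add
      · calc _ ≤ ∫ y, kap lam (y - s) := by
              apply setIntegral_le_integral hi
              exact Eventually.of_forall (fun y => kap_nonneg lam _)
          _ = _ := integral_sub_right_eq_self (kap lam) s
      · simp; norm_num
    rw [integrable_prod_iff hmeas]
    have hsl : ∀ t ∈ Ioc (0 : ℝ) 1, Integrable
        (fun y => phD a lam ζ 0 (x + t * (y - x)) * (η y * G 0 y))
        (volume.restrict (Ioc (-1 : ℝ) 1)) := by
      intro t ht
      refine Integrable.mono' ((hki (x + (a - x) / t)).const_mul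
        (W * (C * (t ^ (lam - 1) + 2 ^ (lam - 1))))) ?_ (Eventually.of_forall (hbd t ht))
      apply AEStronglyMeasurable.mul _ hGm
      apply Measurable.aestronglyMeasurable
      apply (phD_measurable a lam hζ 0).comp
      fun_prop
    constructor
    · filter_upwards [ae_restrict_mem measurableSet_Ioc] with t ht using hsl t ht
    · have hIm' := hIm
      rw [intervalIntegrable_iff_integrableOn_Ioc_of_le zero_le_one] at hIm'
      refine Integrable.mono' (hIm'.const_mul (W * C * ((∫ v, kap lam v) + 2)))
        hmeas.norm.integral_prod_right' ?_
      filter_upwards [ae_restrict_mem measurableSet_Ioc] with t ht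
      rw [Real.norm_of_nonneg (integral_nonneg (fun y => norm_nonneg _))]
      calc _ ≤ ∫ y in Ioc (-1 : ℝ) 1, W * (C * (t ^ (lam - 1) + 2 ^ (lam - 1))) *
              (kap lam (y - (x + (a - x) / t)) + 1) := by
            apply integral_mono (hsl t ht).norm ((hki _).const_mul _)
            intro y; exact hbd t ht y
        _ = W * (C * (t ^ (lam - 1) + 2 ^ (lam - 1))) *
              ∫ y in Ioc (-1 : ℝ) 1, (kap lam (y - (x + (a - x) / t)) + 1) := by
            rw [integral_const_mul]
        _ ≤ W * (C * (t ^ (lam - 1) + 2 ^ (lam - 1))) * ((∫ v, kap lam v) + 2) := by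
            apply mul_le_mul_of_nonneg_left (hkb _)
            exact mul_nonneg hW0 (hp t ht)
        _ = _ := by ring
  · intro t ht
    set s := x + (a - x) / t with hs
    obtain ⟨h1, h2, h3, h4, h5⟩ := hT x hx t ht s hs
    have := osc_decay hG hlam hlK (hp t ht) hP hn (oscT a lam ζ η x t) h1 h2 h3 h4 h5
    simp only [oscT_zero, mul_assoc] at this
    refine this.trans (le_of_eq ?_)
    rw [hD, hR]; ring

open MeasureTheory Set Filter Topology
open scoped ContDiff

lemma phiFunI_eq (a lam : ℝ) (hlam : 0 < lam) (z : ℝ → ℝ) (u : ℝ) :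
    phiFunI a lam z u = if a < u then z u * (u - a) ^ lam else 0 := by
  unfold phiFunI
  rw [if_neg hlam.ne']
  rcases lt_trichotomy u a with h | h | h
  · rw [if_pos h, if_neg (not_lt.2 h.le)]
  · rw [if_neg (by linarith), if_pos h, if_neg (by linarith)]
  · rw [if_neg (by linarith), if_neg h.ne', if_pos h]

lemma cut_contDiff {a ε : ℝ} (hε : |a| + ε < 1) (χ : ContDiffBump a) (hχ : χ.rOut = ε) {z : ℝ → ℝ}
    (hz : ContDiffOn ℝ ∞ z (Icc (-1 : ℝ) 1)) : ContDiff ℝ ∞ (fun u => χ u * z u) := by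
  rw [contDiff_iff_contDiffAt]
  intro u
  by_cases hu : |u| < 1
  · have := hz.contDiffAt (Icc_mem_nhds (abs_lt.1 hu).1 (abs_lt.1 hu).2)
    exact χ.contDiff.contDiffAt.mul this
  · have hu' : ε < |u - a| := by
      have := abs_sub_abs_le_abs_sub u a
      linarith
    have e : (fun u => χ u * z u) =ᶠ[𝓝 u] fun _ => 0 := by
      have : {u : ℝ | ε < |u - a|} ∈ 𝓝 u :=
        (isOpen_lt continuous_const (by fun_prop)).mem_nhds hu'
      filter_upwards [this] with v hv
      rw [χ.zero_of_le_dist (by rw [hχ, Real.dist_eq]; exact le_of_lt hv), zero_mul]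
    exact contDiffAt_const.congr_of_eventuallyEq e

lemma rest_contDiff {a lam : ℝ} (hlam : 0 < lam) (χ : ContDiffBump a) {z : ℝ → ℝ}
    (hz : ContDiffOn ℝ ∞ z (Icc (-1 : ℝ) 1)) :
    ContDiffOn ℝ ∞ (fun u => (1 - χ u) * phiFunI a lam z u) (Icc (-1 : ℝ) 1) := by
  intro u hu
  have hc : ContDiffWithinAt ℝ ∞ (fun u => 1 - χ u) (Icc (-1 : ℝ) 1) u :=
    (contDiff_const.sub χ.contDiff).contDiffWithinAt
  rcases lt_trichotomy u a with h | h | h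
  · have e : (fun u => (1 - χ u) * phiFunI a lam z u) =ᶠ[𝓝 u] fun _ => 0 := by
      filter_upwards [Iio_mem_nhds h] with v hv
      have hv : v < a := hv
      rw [phiFunI_eq a lam hlam, if_neg (not_lt.2 hv.le), mul_zero]
    exact (contDiffAt_const.congr_of_eventuallyEq e).contDiffWithinAt
  · have e : (fun u => (1 - χ u) * phiFunI a lam z u) =ᶠ[𝓝 u] fun _ => 0 := by
      rw [h]
      filter_upwards [χ.eventuallyEq_one] with v hv
      rw [hv]; simp
    exact (contDiffAt_const.congr_of_eventuallyEq e).contDiffWithinAt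
  · have e : (fun u => (1 - χ u) * phiFunI a lam z u) =ᶠ[𝓝 u]
        fun u => (1 - χ u) * (z u * (u - a) ^ lam) := by
      filter_upwards [Ioi_mem_nhds h] with v hv
      have hv : a < v := hv
      rw [phiFunI_eq a lam hlam, if_pos hv]
    refine ContDiffWithinAt.congr_of_eventuallyEq ?_ (e.filter_mono nhdsWithin_le_nhds) e.self_of_nhds
    refine hc.mul ((hz u hu).mul ?_)
    apply ContDiffAt.contDiffWithinAt
    exact ContDiffAt.rpow_const_of_ne (by fun_prop) (by linarith)

lemma within_tower {f : ℝ → ℝ} (hf : ContDiffOn ℝ ∞ f (Icc (-1 : ℝ) 1)) :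
    ∃ F : ℕ → ℝ → ℝ, F 0 = f ∧ (∀ j, ContinuousOn (F j) (Icc (-1) 1)) ∧
      (∀ j, ∀ y ∈ Ioo (-1 : ℝ) 1, HasDerivAt (F j) (F (j + 1) y) y) := by
  have hu : UniqueDiffOn ℝ (Icc (-1 : ℝ) 1) := uniqueDiffOn_Icc (by norm_num)
  refine ⟨fun j => iteratedDerivWithin j f (Icc (-1) 1), ?_, ?_, ?_⟩
  · exact iteratedDerivWithin_zero
  · intro j
    exact hf.continuousOn_iteratedDerivWithin (by exact_mod_cast le_top) hu
  · intro j y hy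
    have hd := hf.differentiableOn_iteratedDerivWithin (m := j)
      (by exact_mod_cast WithTop.coe_lt_top _) hu y (Ioo_subset_Icc_self hy)
    have := hd.hasDerivWithinAt.hasDerivAt (Icc_mem_nhds hy.1 hy.2)
    simp only [iteratedDerivWithin_succ]
    exact this

theorem coeffG_uniform_decay_typeI (α β a lam : ℝ) (hα : -1 < α) (hβ : -1 < β)
    (ha : a ∈ Set.Ioo (-1 : ℝ) 1) (hlam : 0 < lam)
    (z : ℝ → ℝ) (hz : ContDiffOn ℝ (⊤ : ℕ∞) z (Set.Icc (-1 : ℝ) 1)) (hza : z a ≠ 0) :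
    ∃ C : ℝ, 0 < C ∧ ∃ N : ℕ, ∀ n : ℕ, N ≤ n → ∀ x ∈ Set.Icc (-1 : ℝ) 1,
      |jacobiCoeffG α β n (phiFunI a lam z) x| ≤ C * (n : ℝ) ^ (-lam + 1 / 2) := by
  obtain ⟨K, hK⟩ := exists_nat_gt lam
  have haa : |a| < 1 := abs_lt.2 ha
  set ε := (1 - |a|) / 4 with hε
  have hε0 : 0 < ε := by rw [hε]; linarith
  set B := |a| + 3 * ε with hB
  have hB0 : 0 < B := by have := abs_nonneg a; positivity
  have hB1 : B < 1 := by rw [hB, hε]; linarith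
  let χ : ContDiffBump a := ⟨ε / 2, ε, by linarith, by linarith⟩
  let η : ContDiffBump a := ⟨2 * ε, 3 * ε, by linarith, by linarith⟩
  have hη : ContDiff ℝ ∞ (fun u => η u) := η.contDiff
  have hηB : ∀ y, B < |y| → η y = 0 := by
    intro y hy
    apply η.zero_of_le_dist
    have := abs_sub_abs_le_abs_sub y a
    rw [Real.dist_eq]
    change 3 * ε ≤ _
    linarith
  have hζ := cut_contDiff (by rw [hε]; linarith) χ rfl hz (ε := ε)
  set ζ : ℝ → ℝ := fun u => χ u * z u with hζd
  set f := phiFunI a lam z with hf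
  set f1 := phF a lam ζ with hf1
  have e1 : ∀ u, f1 u = χ u * f u := by
    intro u
    rw [hf, phiFunI_eq a lam hlam, hf1, phF]
    split_ifs
    · rw [hζd]; ring
    · ring
  have e2 : ∀ u, f1 u * η u = f1 u := by
    intro u
    rcases le_total (|u - a|) (2 * ε) with h | h
    · rw [η.one_of_mem_closedBall (by rw [Metric.mem_closedBall, Real.dist_eq]; exact h), mul_one]
    · have : χ u = 0 := by
        apply χ.zero_of_le_dist
        rw [Real.dist_eq]; change ε ≤ _; linarith
      rw [e1, this]; ring
  obtain ⟨F, hF0, hFc, hFd⟩ := within_tower (rest_contDiff hlam χ hz)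
  obtain ⟨C1, hC1, H1⟩ := smooth_part F hFc hFd K
  obtain ⟨C2, hC2, H2⟩ := smooth_part (fun j => iteratedDeriv j η)
    (fun j => (iterD_cont hη j).continuousOn) (fun j y _ => iterD_der hη j y) K
  obtain ⟨C3, hC3, H3⟩ := osc_part ha hB1.le hlam hζ hη hηB K hK
  obtain ⟨Mf, hMf⟩ := isCompact_Icc.exists_bound_of_continuousOn
    (phF_cont a lam hlam hζ).continuousOn (s := Icc (-1 : ℝ) 1)
  have hMf0 : 0 ≤ Mf := (norm_nonneg _).trans (hMf 0 (by simp))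
  obtain ⟨P, hP, N1, hGT⟩ := jG_GT α β B hα hβ hB0 hB1 K
  obtain ⟨c, c', hc, hc', N2, hsig⟩ := sigma_bounds α β hα hβ
  refine ⟨1 / c * ((C1 + Mf * C2 + C3) * P), by positivity, N1 + N2 + 1, fun n hn x hx => ?_⟩
  have hn1 : 1 ≤ n := by omega
  have np : (0 : ℝ) < n := by exact_mod_cast hn1
  have hG := hGT n (by omega)
  obtain ⟨hs1, -⟩ := hsig n (by omega)
  obtain ⟨i1, b1⟩ := H1 n B P _ hG x hx
  obtain ⟨i2, b2⟩ := H2 n B P _ hG x hx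
  obtain ⟨i3, b3⟩ := H3 n P _ hn1 hP.le hG x hx
  have hIntg : ∫ y in (-1 : ℝ)..1, (f x - f y) / (x - y) * jacobiP α β n y * jacobiWeight α β y =
      (∫ y in (-1 : ℝ)..1, (F 0 x - F 0 y) / (x - y) * jG α β n 0 y) +
      f1 x * (∫ y in (-1 : ℝ)..1, (iteratedDeriv 0 η x - iteratedDeriv 0 η y) / (x - y) *
        jG α β n 0 y) +
      ∫ y in (-1 : ℝ)..1, (f1 x - f1 y) / (x - y) * (η y * jG α β n 0 y) := by
    rw [← intervalIntegral.integral_const_mul, ← intervalIntegral.integral_add i1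
      (i2.const_mul _), ← intervalIntegral.integral_add (i1.add (i2.const_mul _)) i3]
    apply intervalIntegral.integral_congr_ae
    have h1 : ∀ᵐ y : ℝ, y ≠ 1 := Measure.ae_ne volume 1
    filter_upwards [h1] with y hy1 hy
    rw [uIoc_of_le (by norm_num)] at hy
    rw [jacobiP_eq α β n ⟨hy.1, lt_of_le_of_ne hy.2 hy1⟩, jG_zero, hF0]
    simp only [iteratedDeriv_zero]
    have hx' := e1 x
    have hy' := e1 y
    have hx2 := e2 x
    have hy2 := e2 y
    have hnum : f x - f y = ((1 - χ x) * f x - (1 - χ y) * f y) + f1 x * (η x - η y) +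
        (f1 x - f1 y) * η y := by
      linear_combination hy' - hx' - hx2 + hy2
    rw [hnum]; ring
  have hpow : (n : ℝ) ^ (-(1 / 2) - K : ℝ) ≤ (n : ℝ) ^ (-(1 / 2) - lam : ℝ) :=
    Real.rpow_le_rpow_of_exponent_le (by exact_mod_cast hn1) (by linarith)
  set Q := (n : ℝ) ^ (-(1 / 2) - lam : ℝ) with hQ
  have hQ0 : 0 < Q := Real.rpow_pos_of_pos np _
  have hsum : |∫ y in (-1 : ℝ)..1, (f x - f y) / (x - y) * jacobiP α β n y * jacobiWeight α β y| ≤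
      (C1 + Mf * C2 + C3) * P * Q := by
    rw [hIntg]
    refine (abs_add_three _ _ _).trans ?_
    have hfx : |f1 x| ≤ Mf := hMf x hx
    rw [abs_mul]
    calc _ ≤ C1 * (P * Q) + Mf * (C2 * (P * Q)) + C3 * (P * Q) := by
          gcongr
          · exact b1.trans (by gcongr)
          · exact b2.trans (by gcongr)
      _ = _ := by ring
  have hsp : 0 < jacobiSigma α β n := lt_of_lt_of_le (by positivity) hs1
  have hinv : 1 / jacobiSigma α β n ≤ n / c := by
    rw [div_le_div_iff₀ hsp hc]
    rw [div_le_iff₀ np] at hs1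
    linarith
  unfold jacobiCoeffG jacobiCoeff
  rw [abs_mul, abs_of_pos (by positivity : 0 < 1 / jacobiSigma α β n)]
  calc _ ≤ (n / c) * ((C1 + Mf * C2 + C3) * P * Q) := by
        gcongr
    _ = 1 / c * ((C1 + Mf * C2 + C3) * P) * (n * Q) := by ring
    _ = _ := by
        congr 1
        rw [hQ]
        nth_rewrite 1 [← Real.rpow_one (n : ℝ)]
        rw [← Real.rpow_add np]; congr 1; ring
end

section
/- Let α,β>-1, let λ be a positive even integer, and let a∈(-1,1). Then there exist constants C>0 and N such that for all integers n≥N, |P_{n-λ}^{(α+λ,β+λ)}(a)·P_{n+1}^{(α,β)}(a) − P_{n+1-λ}^{(α+λ,β+λ)}(a)·P_n^{(α,β)}(a)| ≤ C n^{-2}. -/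
open MeasureTheory Set

open Topology Filter

namespace JC

/-- the weight function -/
noncomputable def f (p q : ℝ) (y : ℝ) : ℝ := (1 - y) ^ p * (1 + y) ^ q

lemma f_smooth (p q : ℝ) (n : WithTop ℕ∞) : ContDiffOn ℝ n (f p q) (Ioo (-1) 1) := by
  unfold f
  apply ContDiffOn.mul
  · apply ContDiffOn.rpow_const_of_ne (by fun_prop)
    intro x hx; have := hx.2; linarith
  · apply ContDiffOn.rpow_const_of_ne (by fun_prop)
    intro x hx; have := hx.1; linarith

lemma itd_congr {U : Set ℝ} (hU : IsOpen U) {g h : ℝ → ℝ} (hgh : EqOn g h U) (n : ℕ) :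
    EqOn (iteratedDeriv n g) (iteratedDeriv n h) U := by
  intro x hx
  have : g =ᶠ[𝓝 x] h := by
    filter_upwards [hU.mem_nhds hx] with y hy using hgh hy
  exact this.iteratedDeriv_eq n

lemma itd_diff {U : Set ℝ} (hU : IsOpen U) {g : ℝ → ℝ} (hg : ContDiffOn ℝ ⊤ g U) (n : ℕ)
    {x : ℝ} (hx : x ∈ U) : HasDerivAt (iteratedDeriv n g) (iteratedDeriv (n+1) g x) x := by
  have h1 : ContDiffAt ℝ (n+1 : ℕ) g x := ((hg.contDiffAt (hU.mem_nhds hx)).of_le le_top)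
  have h2 : DifferentiableAt ℝ (iteratedFDeriv ℝ n g) x :=
    h1.differentiableAt_iteratedFDeriv (by exact_mod_cast Nat.lt_succ_self n)
  have : DifferentiableAt ℝ (iteratedDeriv n g) x := by
    rw [iteratedDeriv_eq_equiv_comp]
    exact (LinearIsometryEquiv.differentiableAt _).comp x h2
  rw [iteratedDeriv_succ]
  exact this.hasDerivAt

lemma itd_id_mul {U : Set ℝ} (hU : IsOpen U) {g : ℝ → ℝ} (hg : ContDiffOn ℝ ⊤ g U) (n : ℕ) :
    ∀ x ∈ U, iteratedDeriv n (fun y => y * g y) x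
      = x * iteratedDeriv n g x + n * iteratedDeriv (n-1) g x := by
  induction n with
  | zero => intro x hx; simp
  | succ n ih =>
    intro x hx
    rw [iteratedDeriv_succ]
    have : iteratedDeriv n (fun y => y * g y) =ᶠ[𝓝 x]
      fun x => x * iteratedDeriv n g x + n * iteratedDeriv (n-1) g x := by
      filter_upwards [hU.mem_nhds hx] with y hy using ih y hy
    rw [this.deriv_eq]
    have h1 := (hasDerivAt_id x).mul (itd_diff hU hg n hx)
    have h2 := (itd_diff hU hg (n-1) hx).const_mul (n:ℝ)
    have h3 := (h1.add h2).deriv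
    simp only [id, Pi.add_def, Pi.mul_def] at h3
    rw [h3]
    rcases n with _ | n
    · simp; ring
    · simp; ring

lemma itd_lin {U : Set ℝ} (hU : IsOpen U) {g : ℝ → ℝ} (hg : ContDiffOn ℝ ⊤ g U) (n : ℕ)
    (c e : ℝ) : ∀ x ∈ U, iteratedDeriv n (fun y => (c - e * y) * g y) x
      = (c - e * x) * iteratedDeriv n g x - e * n * iteratedDeriv (n-1) g x := by
  intro x hx
  have e1 : (fun y => (c - e * y) * g y) = fun y => c * g y - e * (y * g y) := by
    ext y; ring
  have hgx := (hg.contDiffAt (hU.mem_nhds hx)).of_le (le_top : (n : WithTop ℕ∞) ≤ ⊤)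
  rw [e1, iteratedDeriv_fun_sub (by fun_prop) (by fun_prop), iteratedDeriv_const_mul_field,
    iteratedDeriv_const_mul_field, itd_id_mul hU hg n x hx]
  ring

lemma itd_quad {U : Set ℝ} (hU : IsOpen U) {g : ℝ → ℝ} (hg : ContDiffOn ℝ ⊤ g U) (n : ℕ) :
    ∀ x ∈ U, iteratedDeriv n (fun y => (1 - y ^ 2) * g y) x
      = (1 - x ^ 2) * iteratedDeriv n g x - 2 * n * x * iteratedDeriv (n-1) g x
        - n * (n - 1) * iteratedDeriv (n-2) g x := by
  intro x hx
  have e1 : (fun y => (1 - y^2) * g y) = fun y => g y - (y * (y * g y)) := by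
    ext y; ring
  have hgx := (hg.contDiffAt (hU.mem_nhds hx)).of_le (le_top : (n : WithTop ℕ∞) ≤ ⊤)
  have hg2 : ContDiffOn ℝ ⊤ (fun y => y * g y) U := contDiffOn_id.mul hg
  rw [e1, iteratedDeriv_fun_sub (by fun_prop) (by fun_prop), itd_id_mul hU hg2 n x hx, 
    itd_id_mul hU hg n x hx, itd_id_mul hU hg (n-1) x hx]
  rcases n with _ | n
  · simp; ring
  · simp; ring_nf

lemma f_step {p q y : ℝ} (hy : y ∈ Ioo (-1:ℝ) 1) : f (p+1) (q+1) y = (1 - y^2) * f p q y := by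
  have h1 : 0 < 1 - y := by linarith [hy.2]
  have h2 : 0 < 1 + y := by linarith [hy.1]
  unfold f
  rw [Real.rpow_add_one h1.ne', Real.rpow_add_one h2.ne']; ring

lemma f_deriv {p q y : ℝ} (hy : y ∈ Ioo (-1:ℝ) 1) : 
    deriv (f (p+1) (q+1)) y = ((q - p) - (p + q + 2) * y) * f p q y := by
  have h1 : 0 < 1 - y := by linarith [hy.2]
  have h2 : 0 < 1 + y := by linarith [hy.1]
  have d1 := ((hasDerivAt_id y).const_sub 1).rpow_const (p := p+1) (Or.inl h1.ne')
  have d2 := ((hasDerivAt_id y).const_add 1).rpow_const (p := q+1) (Or.inl h2.ne')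
  have := (d1.mul d2).deriv
  simp only [id, Pi.mul_def] at this
  unfold f
  rw [this, Real.rpow_add_one h1.ne', Real.rpow_add_one h2.ne']
  simp only [add_sub_cancel_right]
  ring

lemma relA {p q x : ℝ} (n : ℕ) (hx : x ∈ Ioo (-1:ℝ) 1) :
    iteratedDeriv (n+1) (f (p+1) (q+1)) x = ((q - p) - (p + q + 2) * x) * iteratedDeriv n (f p q) x
      - (p + q + 2) * n * iteratedDeriv (n-1) (f p q) x := by
  rw [iteratedDeriv_succ', itd_congr isOpen_Ioo (fun y hy => f_deriv hy) n hx]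
  exact itd_lin isOpen_Ioo (f_smooth p q ⊤) n _ _ x hx

lemma relC {p q x : ℝ} (n : ℕ) (hx : x ∈ Ioo (-1:ℝ) 1) :
    iteratedDeriv n (f (p+1) (q+1)) x = (1 - x^2) * iteratedDeriv n (f p q) x
      - 2 * n * x * iteratedDeriv (n-1) (f p q) x - n * (n-1) * iteratedDeriv (n-2) (f p q) x := by
  rw [itd_congr isOpen_Ioo (fun y hy => f_step hy) n hx]
  exact itd_quad isOpen_Ioo (f_smooth p q ⊤) n x hx

lemma relB {p q x : ℝ} (n : ℕ) (hx : x ∈ Ioo (-1:ℝ) 1) :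
    (1 - x^2) * iteratedDeriv (n+2) (f p q) x + ((p + q - 2 * (n+1)) * x - (q - p)) * 
      iteratedDeriv (n+1) (f p q) x = - (n+1) * (p + q - n) * iteratedDeriv n (f p q) x := by
  have hd : ContDiffOn ℝ ⊤ (deriv (f p q)) (Ioo (-1) 1) := 
    (f_smooth p q ⊤).deriv_of_isOpen isOpen_Ioo (by simp)
  have h1 := itd_quad isOpen_Ioo hd (n+1) x hx
  have h2 := itd_lin isOpen_Ioo (f_smooth p q ⊤) (n+1) (q-p) (p+q) x hx
  have h3 : iteratedDeriv (n+1) (fun y => (1 - y^2) * deriv (f p q) y) x = 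
      iteratedDeriv (n+1) (fun y => ((q-p) - (p+q)*y) * f p q y) x := by
    refine itd_congr isOpen_Ioo (fun y hy => ?_) (n+1) hx
    have e1 := f_deriv (p := p-1) (q := q-1) hy
    have e2 := f_step (p := p-1) (q := q-1) hy
    simp only [sub_add_cancel] at e1 e2
    rw [e1, e2]; ring
  rw [h1, h2] at h3
  rw [← iteratedDeriv_succ', ← iteratedDeriv_succ'] at h3
  rcases n with _ | n
  · simp at h3 ⊢; linear_combination h3
  · simp only [show n + 1 + 1 - 2 = n by omega, show n+1+1-1 = n+1 by omega] at h3
    rw [← iteratedDeriv_succ'] at h3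
    push_cast at h3 ⊢
    linear_combination h3


noncomputable def T (α β x : ℝ) (j n : ℕ) : ℝ := jacobiP (α + j) (β + j) (n - j) x

lemma T_key {α β x : ℝ} (j k : ℕ) (hx : x ∈ Ioo (-1:ℝ) 1) :
    iteratedDeriv k (f (((k + j : ℕ) : ℝ) + α) (((k + j : ℕ) : ℝ) + β)) x =
      (-2) ^ k * k.factorial * ((1 - x) ^ α * (1 + x) ^ β) * (1 - x ^ 2) ^ j * T α β x j (k + j) := by
  have h1 : 0 < 1 - x := by linarith [hx.2]
  have h2 : 0 < 1 + x := by linarith [hx.1]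
  unfold T jacobiP
  rw [show k + j - j = k by omega]
  have e : (fun y : ℝ => (1 - y) ^ ((k : ℝ) + (α + j)) * (1 + y) ^ ((k : ℝ) + (β + j)))
      = f (((k + j : ℕ) : ℝ) + α) (((k + j : ℕ) : ℝ) + β) := by
    ext y; unfold f; push_cast; congr 2 <;> ring
  rw [e, Real.rpow_neg h1.le, Real.rpow_neg h2.le, Real.rpow_add h1, Real.rpow_add h2,
    Real.rpow_natCast, Real.rpow_natCast]
  have p1 := Real.rpow_pos_of_pos h1 α
  have p2 := Real.rpow_pos_of_pos h2 β
  have p3 : (0:ℝ) < k.factorial := by exact_mod_cast k.factorial_pos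
  rw [show (1 - x^2) = (1-x)*(1+x) by ring, mul_pow, show (-2:ℝ) = (-1) * 2 by ring, mul_pow]
  have p4 : ((-1:ℝ)^k) * (-1)^k = 1 := by rw [← mul_pow]; simp
  field_simp
  linear_combination (-iteratedDeriv k (f (((k + j : ℕ) : ℝ) + α) (((k + j : ℕ) : ℝ) + β)) x) * p4

lemma W_ne {α β x : ℝ} (j k : ℕ) (hx : x ∈ Ioo (-1:ℝ) 1) :
    (-2 : ℝ) ^ k * k.factorial * ((1 - x) ^ α * (1 + x) ^ β) * (1 - x ^ 2) ^ j ≠ 0 := by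
  have h1 : 0 < 1 - x := by linarith [hx.2]
  have h2 : 0 < 1 + x := by linarith [hx.1]
  have p1 := Real.rpow_pos_of_pos h1 α
  have p2 := Real.rpow_pos_of_pos h2 β
  have p3 : (0:ℝ) < k.factorial := by exact_mod_cast k.factorial_pos
  have p4 : 0 < 1 - x^2 := by nlinarith
  have p5 : (-2:ℝ)^k ≠ 0 := by apply pow_ne_zero; norm_num
  positivity

lemma TB {α β x : ℝ} (j n : ℕ) (hn : j + 2 ≤ n) (hx : x ∈ Ioo (-1:ℝ) 1) :
    4 * ((n:ℝ) - j) * T α β x j n + 2 * ((β - α) - (α + β + 2 * j + 2) * x) * T α β x (j+1) n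
      = - (n + j + 2 + (α + β)) * (1 - x^2) * T α β x (j+2) n := by
  obtain ⟨m, rfl⟩ := Nat.exists_eq_add_of_le' hn
  have k0 := T_key (α := α) (β := β) j (m+2) hx
  have k1 := T_key (α := α) (β := β) (j+1) (m+1) hx
  have k2 := T_key (α := α) (β := β) (j+2) m hx
  rw [show m + 2 + j = m + (j + 2) by ring] at k0
  rw [show m + 1 + (j + 1) = m + (j + 2) by ring] at k1
  have r := relB (p := ((m + (j+2) : ℕ):ℝ) + α) (q := ((m + (j+2) : ℕ):ℝ) + β) m hx
  rw [k0, k1, k2] at r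
  have p4 : 1 - x^2 ≠ 0 := by nlinarith [hx.1, hx.2]
  have p5 : (m:ℝ) + 1 ≠ 0 := by positivity
  apply mul_left_cancel₀ (W_ne (α := α) (β := β) j m hx)
  apply mul_left_cancel₀ p4
  apply mul_left_cancel₀ p5
  simp only [Nat.factorial_succ] at r
  push_cast at r ⊢
  linear_combination r

lemma TA {α β x : ℝ} (n : ℕ) (hn : 1 ≤ n) (hx : x ∈ Ioo (-1:ℝ) 1) :
    2 * ((n:ℝ) + 1) * T α β x 0 (n+1) = - ((β - α) - (2 * n + (α + β) + 2) * x) * T α β x 0 n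
      - (2 * n + (α + β) + 2) / 2 * (1 - x^2) * T α β x 1 n := by
  obtain ⟨m, rfl⟩ := Nat.exists_eq_add_of_le' hn
  have k0 := T_key (α := α) (β := β) 0 (m+2) hx
  have k1 := T_key (α := α) (β := β) 0 (m+1) hx
  have k2 := T_key (α := α) (β := β) 1 m hx
  have r := relA (p := ((m + 1 : ℕ):ℝ) + α) (q := ((m + 1 : ℕ):ℝ) + β) (m+1) hx
  rw [show (((m + 1 : ℕ):ℝ) + α) + 1 = ((m + 2 + 0 : ℕ):ℝ) + α by push_cast; ring,
    show (((m + 1 : ℕ):ℝ) + β) + 1 = ((m + 2 + 0 : ℕ):ℝ) + β by push_cast; ring] at r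
  simp only [add_zero, Nat.add_sub_cancel] at k0 k1 r
  rw [show m + 1 + 1 = m + 2 by ring, k0, k1, k2] at r
  have p5 : (m:ℝ) + 1 ≠ 0 := by positivity
  apply mul_left_cancel₀ (W_ne (α := α) (β := β) 0 m hx)
  apply mul_left_cancel₀ p5
  simp only [Nat.factorial_succ] at r
  push_cast at r ⊢
  linear_combination r / 2

lemma TC {α β x : ℝ} (n : ℕ) (hn : 2 ≤ n) (hx : x ∈ Ioo (-1:ℝ) 1) :
    4 * T α β x 1 (n+1) = 4 * T α β x 0 n + 4 * x * T α β x 1 n - (1 - x^2) * T α β x 2 n := by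
  obtain ⟨m, rfl⟩ := Nat.exists_eq_add_of_le' hn
  have k0 := T_key (α := α) (β := β) 0 (m+2) hx
  have k1 := T_key (α := α) (β := β) 1 (m+1) hx
  have k2 := T_key (α := α) (β := β) 2 m hx
  have k3 := T_key (α := α) (β := β) 1 (m+2) hx
  have r := relC (p := ((m + 2 : ℕ):ℝ) + α) (q := ((m + 2 : ℕ):ℝ) + β) (m+2) hx
  rw [show (((m + 2 : ℕ):ℝ) + α) + 1 = ((m + 2 + 1 : ℕ):ℝ) + α by push_cast; ring,
    show (((m + 2 : ℕ):ℝ) + β) + 1 = ((m + 2 + 1 : ℕ):ℝ) + β by push_cast; ring] at r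
  simp only [add_zero, Nat.add_sub_cancel, show m + 2 - 1 = m + 1 by omega,
    show m + 1 + 1 = m + 2 by ring] at k0 k1 r
  rw [k0, k1, k2, k3] at r
  have p4 : 1 - x^2 ≠ 0 := by nlinarith [hx.1, hx.2]
  have p5 : (m:ℝ) + 1 ≠ 0 := by positivity
  have p6 : (m:ℝ) + 2 ≠ 0 := by positivity
  apply mul_left_cancel₀ (W_ne (α := α) (β := β) 0 m hx)
  apply mul_left_cancel₀ p5
  apply mul_left_cancel₀ p6
  apply mul_left_cancel₀ p4
  simp only [Nat.factorial_succ] at r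
  push_cast at r ⊢
  linear_combination r

lemma three_term {α β x : ℝ} (n : ℕ) (hn : 2 ≤ n) (hx : x ∈ Ioo (-1:ℝ) 1) :
    2 * ((n:ℝ) + 2) * (n + (α + β) + 2) * (2 * n + (α + β) + 2) * T α β x 0 (n+2) =
      (2 * n + (α + β) + 3) * ((2 * n + (α + β) + 4) * (2 * n + (α + β) + 2) * x + (α^2 - β^2))
        * T α β x 0 (n+1) - 2 * (n + 1 + α) * (n + 1 + β) * (2 * n + (α + β) + 4) * T α β x 0 n := by
  have a0 := TA (α := α) (β := β) n (by omega) hx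
  have a1 := TA (α := α) (β := β) (n+1) (by omega) hx
  have b := TB (α := α) (β := β) 0 n (by omega) hx
  have c := TC (α := α) (β := β) n (by omega) hx
  simp only [zero_add] at b
  rw [show n + 1 + 1 = n + 2 by ring] at a1
  push_cast at a0 a1 b c
  linear_combination (n + (α + β) + 2) * (2 * n + (α + β) + 2) * a1
    - ((2 * n + (α + β) + 4) / 2 * (1 - x^2) / 4 * (n + (α + β) + 2) * (2 * n + (α + β) + 2)) * c
    + ((2 * n + (α + β) + 4) / 2 * (1 - x^2) / 4 * (2 * n + (α + β) + 2)) * b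
    - (2 * n + (α + β) + 4) * ((β - α) + (2 * n + (α + β) + 2) * x) / 2 * a0

lemma rho_bound {α β x : ℝ} (hα : -1 < α) (hβ : -1 < β) (hx : x ∈ Ioo (-1:ℝ) 1) :
    ∃ K : ℝ, 0 ≤ K ∧ ∀ n : ℕ, 2 ≤ n →
      |((n:ℝ) + 2) * T α β x 0 (n+2) - (2 * n + 3) * x * T α β x 0 (n+1) + (n + 1) * T α β x 0 n|
        ≤ K / n * (|T α β x 0 n| + |T α β x 0 (n+1)|) := by
  set s := α + β with hs
  refine ⟨|s^2+s| + 2 * |α^2-β^2| + 2 * |s| + 4 * |α * β|, by positivity, fun n hn => ?_⟩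
  have h3 := three_term (α := α) (β := β) n hn hx
  rw [← hs] at h3
  set v := T α β x 0 (n+2)
  set q := T α β x 0 (n+1)
  set p := T α β x 0 n
  have hn' : (2:ℝ) ≤ n := by exact_mod_cast hn
  have hs2 : -2 < s := by linarith
  set ρ := ((n:ℝ) + 2) * v - (2 * n + 3) * x * q + (n + 1) * p with hρ
  have hD : 0 < 2 * (n:ℝ) + s + 2 := by linarith
  have e : ρ * (2 * (n + s + 2)) = q * (x * (s^2+s) + (2*n+s+3)/(2*n+s+2) * (α^2-β^2))
      - p * (2 * s * ((n+1)/(2*n+s+2)) + 2 * (α * β) * ((2*n+s+4)/(2*n+s+2))) := by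
    field_simp
    rw [hρ, hs] at *
    linear_combination h3
  have b1 : |x * (s^2+s) + (2*n+s+3)/(2*n+s+2) * (α^2-β^2)| ≤ |s^2+s| + 2 * |α^2-β^2| := by
    refine (abs_add_le _ _).trans ?_
    rw [abs_mul, abs_mul]
    have : |x| ≤ 1 := abs_le.2 ⟨hx.1.le, hx.2.le⟩
    have h2 : |(2*n+s+3)/(2*n+s+2)| ≤ 2 := by
      rw [abs_of_nonneg (div_nonneg (by linarith) hD.le), div_le_iff₀ hD]; linarith
    have := mul_le_mul_of_nonneg_right this (abs_nonneg (s^2+s))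
    have := mul_le_mul_of_nonneg_right h2 (abs_nonneg (α^2-β^2))
    linarith
  have b2 : |2 * s * ((n+1)/(2*n+s+2)) + 2 * (α * β) * ((2*n+s+4)/(2*n+s+2))| ≤
      2 * |s| + 4 * |α * β| := by
    refine (abs_add_le _ _).trans ?_
    rw [abs_mul, abs_mul, abs_mul, abs_mul 2 (α * β), abs_two]
    have h1 : |((n:ℝ)+1)/(2*n+s+2)| ≤ 1 := by
      rw [abs_of_nonneg (div_nonneg (by linarith) hD.le), div_le_iff₀ hD]; linarith
    have h2 : |(2*n+s+4)/(2*n+s+2)| ≤ 2 := by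
      rw [abs_of_nonneg (div_nonneg (by linarith) hD.le), div_le_iff₀ hD]; linarith
    have := mul_le_mul_of_nonneg_left h1 (by positivity : 0 ≤ 2 * |s|)
    have := mul_le_mul_of_nonneg_left h2 (by positivity : 0 ≤ 2 * |α * β|)
    linarith
  have e2 : |ρ| * (2 * (n + s + 2)) ≤ |q| * (|s^2+s| + 2 * |α^2-β^2|) + |p| * (2 * |s| + 4 * |α * β|) := by
    rw [← abs_of_pos (by linarith : 0 < 2 * (n + s + 2)), ← abs_mul, e]
    refine (abs_sub _ _).trans ?_
    rw [abs_mul, abs_mul]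
    gcongr
  have hn0 : (0:ℝ) < n := by linarith
  rw [div_mul_eq_mul_div, le_div_iff₀ hn0]
  have : |ρ| * n ≤ |ρ| * (2 * (n + s + 2)) := by gcongr; linarith
  have z1 : 0 ≤ |q| * (2 * |s| + 4 * |α * β|) := by positivity
  have z2 : 0 ≤ |p| * (|s^2+s| + 2 * |α^2-β^2|) := by positivity
  linarith

set_option maxHeartbeats 1600000 in
lemma energy {x K : ℝ} (P : ℕ → ℝ) (hx : x ∈ Ioo (-1:ℝ) 1) (hK : 0 ≤ K)
    (h : ∀ n : ℕ, 2 ≤ n → |((n:ℝ) + 2) * P (n+2) - (2 * n + 3) * x * P (n+1) + (n + 1) * P n|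
        ≤ K / n * (|P n| + |P (n+1)|)) :
    ∃ C : ℝ, 0 ≤ C ∧ ∃ N : ℕ, 2 ≤ N ∧ ∀ n, N ≤ n → |P n| ≤ C / √n := by
  have hx1 : |x| < 1 := abs_lt.2 hx
  set F : ℕ → ℝ := fun n => (n+1) * P (n+1)^2 - (2*n+1) * x * P n * P (n+1) + n * P n ^ 2 with hF
  obtain ⟨N0, hN0⟩ := exists_nat_gt (1 / (1 - |x|))
  have h1x : 0 < 1 - |x| := by linarith
  set δ := (1 - |x|) / 2 with hδ
  have hδ0 : 0 < δ := by positivity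
  have Flow : ∀ n : ℕ, N0 ≤ n → δ * n * (P n ^2 + P (n+1)^2) ≤ F n := by
    intro n hn
    have hn' : (N0:ℝ) ≤ n := by exact_mod_cast hn
    have : 1 ≤ n * (1 - |x|) := by
      rw [div_lt_iff₀ h1x] at hN0; nlinarith
    have y1 : (2*n+1) * x * P n * P (n+1) ≤ (n + 1/2) * |x| * (P n ^2 + P (n+1)^2) := by
      have : x * P n * P (n+1) ≤ |x| * ((P n ^2 + P (n+1)^2)/2) := by
        refine (le_abs_self _).trans ?_
        rw [abs_mul, abs_mul, mul_assoc]
        gcongr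
        nlinarith [sq_nonneg (|P n| - |P (n+1)|), sq_abs (P n), sq_abs (P (n+1))]
      have := mul_le_mul_of_nonneg_left this (by positivity : (0:ℝ) ≤ 2 * n + 1)
      linarith
    have y2 : 0 ≤ (P n ^2 + P (n+1)^2) := by positivity
    have y3 : δ * n ≤ n - (n + 1/2) * |x| := by rw [hδ]; linarith
    have y4 := mul_le_mul_of_nonneg_right y3 y2
    have y5 := sq_nonneg (P (n+1))
    simp only [hF]
    linarith
  set K2 := (2 + K) * K + (K + 1) with hK2
  have hK20 : 0 ≤ K2 := by positivity
  have Fstep : ∀ n : ℕ, 2 ≤ n → F (n+1) ≤ F n + 2 * K2 / n * (P n ^2 + P (n+1)^2) := by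
    intro n hn
    have hn' : (2:ℝ) ≤ n := by exact_mod_cast hn
    have hn0 : (0:ℝ) < n := by linarith
    have hh := h n hn
    set v := P (n+2) with hv
    set q := P (n+1) with hq
    set p := P n with hp
    set ρ := ((n:ℝ) + 2) * v - (2 * n + 3) * x * q + (n + 1) * p with hρ
    set S := |p| + |q| with hS
    have hS0 : 0 ≤ S := by positivity
    have ee : F (n+1) = F n + v * ρ - p * (((n+1) * ρ + x * q - p) / (n+2)) := by
      simp only [hF, ← hv, ← hq, ← hp]
      push_cast
      field_simp
      rw [hρ]; ring
    have r1 : |ρ| ≤ K * S := by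
      refine hh.trans ?_
      gcongr
      apply div_le_self hK; linarith
    have xq : |x * q| ≤ |q| := by
      rw [abs_mul]; nlinarith [abs_nonneg q]
    have hvb : |v| ≤ (2 + K) * S := by
      have : v = ((2*n+3) * (x * q) + -((n+1) * p) + ρ) / (n+2) := by
        field_simp; rw [hρ]; ring
      rw [this, abs_div, abs_of_pos (by linarith : (0:ℝ) < n + 2), div_le_iff₀ (by linarith)]
      refine (abs_add_three _ _ _).trans ?_
      rw [abs_neg, abs_mul, abs_mul ((n:ℝ)+1), abs_of_pos (by linarith : (0:ℝ) < 2*n+3),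
        abs_of_pos (by linarith : (0:ℝ) < n+1)]
      have := mul_le_mul_of_nonneg_left xq (by linarith : (0:ℝ) ≤ 2*n+3)
      have := abs_nonneg q
      have := abs_nonneg p
      have : 0 ≤ K * S := by positivity
      nlinarith
    have r2 : |((n+1) * ρ + x * q - p) / (n+2)| ≤ (K + 1) / n * S := by
      rw [abs_div, abs_of_pos (by linarith : (0:ℝ) < n + 2), div_le_iff₀ (by linarith)]
      have t : |(n+1) * ρ + x * q - p| ≤ (n+1) * |ρ| + S := by
        refine (abs_sub _ _).trans ?_
        have := abs_add_le ((n+1) * ρ) (x * q)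
        rw [abs_mul ((n:ℝ)+1), abs_of_pos (by linarith : (0:ℝ) < n+1)] at this
        linarith
      have t2 : (n+1) * |ρ| ≤ (n+2) * (K / n * S) := by
        gcongr; linarith
      have t3 : S ≤ (n+2) * (1 / n * S) := by
        rw [← mul_assoc]
        apply le_mul_of_one_le_left hS0
        rw [mul_one_div, le_div_iff₀ hn0]; linarith
      calc _ ≤ _ := t
        _ ≤ (n+2) * (K / n * S) + (n+2) * (1 / n * S) := by linarith
        _ = _ := by ring
    have s2 : S^2 ≤ 2 * (p^2 + q^2) := by
      nlinarith [sq_nonneg (|p| - |q|), sq_abs p, sq_abs q]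
    have w1 : v * ρ ≤ ((2+K) * S) * (K / n * S) := by
      refine (le_abs_self _).trans ?_
      rw [abs_mul]
      gcongr
    have w2 : - (p * (((n+1) * ρ + x * q - p) / (n+2))) ≤ S * ((K + 1) / n * S) := by
      refine (neg_le_abs _).trans ?_
      rw [abs_mul]
      have : |p| ≤ S := by rw [hS]; linarith [abs_nonneg q]
      gcongr
    have : ((2+K) * S) * (K / n * S) + S * ((K + 1) / n * S) = K2 / n * S^2 := by
      rw [hK2]; ring
    have u : K2 / n * S^2 ≤ K2 / n * (2 * (p^2 + q^2)) := by gcongr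
    have : K2 / n * (2 * (p^2 + q^2)) = 2 * K2 / n * (p^2+q^2) := by ring
    linarith
  set K3 := 2 * K2 / δ with hK3
  have hK30 : 0 ≤ K3 := by positivity
  set N := N0 + 2 with hN
  have Fpos : ∀ n : ℕ, N0 ≤ n → 0 ≤ F n := fun n hn => le_trans (by positivity) (Flow n hn)
  have Gb : ∀ n, N ≤ n → F n * Real.exp (K3 / (n - 1)) ≤ F N * Real.exp (K3 / (N - 1)) := by
    intro n hn
    induction n, hn using Nat.le_induction with
    | base => exact le_rfl
    | succ n hn ih =>
      refine le_trans ?_ ih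
      have hn2 : 2 ≤ n := by omega
      have hn' : (2:ℝ) ≤ n := by exact_mod_cast hn2
      have hn0 : (0:ℝ) < n := by linarith
      have f1 := Fstep n hn2
      have f2 := Flow n (by omega)
      have f3 := Fpos n (by omega)
      have f4 : 2 * K2 / n * (P n ^2 + P (n+1)^2) ≤ K3 / n^2 * F n := by
        calc _ = K3 / n^2 * (δ * n * (P n ^2 + P (n+1)^2)) := by
              rw [hK3]; field_simp
          _ ≤ _ := by gcongr
      have f5 : F (n+1) ≤ F n * Real.exp (K3 / n^2) := by
        have := Real.add_one_le_exp (K3 / n^2)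
        have := mul_le_mul_of_nonneg_left this f3
        linarith
      push_cast
      rw [add_sub_cancel_right]
      calc F (n+1) * Real.exp (K3 / n) ≤ F n * Real.exp (K3 / n^2) * Real.exp (K3 / n) := by gcongr
        _ = F n * Real.exp (K3 / n^2 + K3 / n) := by rw [Real.exp_add]; ring
        _ ≤ _ := by
          gcongr
          have hm : (0:ℝ) < n - 1 := by linarith
          have : K3 / (n - 1) - (K3 / n^2 + K3 / n) = K3 / (n^2 * (n-1)) := by
            field_simp; ring
          have : 0 ≤ K3 / ((n:ℝ)^2 * (n-1)) := by positivity
          linarith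
  set M := F N * Real.exp (K3 / (N - 1)) with hM
  refine ⟨√(M / δ), Real.sqrt_nonneg _, N, by omega, fun n hn => ?_⟩
  have hn2 : 2 ≤ n := by omega
  have hn' : (2:ℝ) ≤ n := by exact_mod_cast hn2
  have hn0 : (0:ℝ) < n := by linarith
  have g1 := Gb n hn
  have g2 := Flow n (by omega)
  have g3 := Fpos n (by omega)
  have g4 : F n ≤ F n * Real.exp (K3 / (n - 1)) := by
    apply le_mul_of_one_le_right g3
    apply Real.one_le_exp
    apply div_nonneg hK30; linarith
  rw [← Real.sqrt_div' _ hn0.le]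
  apply Real.abs_le_sqrt
  rw [div_div, le_div_iff₀ (by positivity)]
  have : 0 ≤ δ * n * P (n+1)^2 := by positivity
  nlinarith

lemma T0_bound {α β x : ℝ} (hα : -1 < α) (hβ : -1 < β) (hx : x ∈ Ioo (-1:ℝ) 1) :
    ∃ C : ℝ, 0 ≤ C ∧ ∃ N : ℕ, 2 ≤ N ∧ ∀ n, N ≤ n → |T α β x 0 n| ≤ C / √n := by
  obtain ⟨K, hK, h⟩ := rho_bound hα hβ hx
  exact energy (fun n => T α β x 0 n) hx hK h

lemma Tj_bound {α β x : ℝ} (hα : -1 < α) (hβ : -1 < β) (hx : x ∈ Ioo (-1:ℝ) 1) (j : ℕ) :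
    ∃ C : ℝ, 0 ≤ C ∧ ∃ N : ℕ, 2 ≤ N ∧ ∀ n, N ≤ n → |T α β x j n| ≤ C / √n := by
  induction j generalizing α β with
  | zero => exact T0_bound hα hβ hx
  | succ j ih =>
    obtain ⟨C, hC, N, hN, h⟩ := ih (α := α + 1) (β := β + 1) (by linarith) (by linarith)
    refine ⟨2 * C, by positivity, N + 1, by omega, fun n hn => ?_⟩
    obtain ⟨m, rfl⟩ := Nat.exists_eq_add_of_le' (show 1 ≤ n by omega)
    have := h m (by omega)
    have e : T α β x (j+1) (m+1) = T (α+1) (β+1) x j m := by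
      unfold T; push_cast
      rw [show α + (j + 1) = α + 1 + (j:ℝ) by ring,
        show β + (j + 1) = β + 1 + (j:ℝ) by ring]
    rw [e]
    refine this.trans ?_
    have hm : (2:ℝ) ≤ m := by exact_mod_cast (show 2 ≤ m by omega)
    have : √((m+1:ℕ):ℝ) ≤ 2 * √(m:ℝ) := by
      apply Real.sqrt_le_iff.2 ⟨by positivity, ?_⟩
      rw [mul_pow, Real.sq_sqrt (by positivity)]; push_cast; linarith
    have s1 : 0 < √(m:ℝ) := Real.sqrt_pos.2 (by linarith)
    have s2 : 0 < √((m+1:ℕ):ℝ) := Real.sqrt_pos.2 (by positivity)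
    rw [div_le_div_iff₀ s1 s2]
    nlinarith

lemma T_even {α β x : ℝ} (hα : -1 < α) (hβ : -1 < β) (hx : x ∈ Ioo (-1:ℝ) 1) (i : ℕ) :
    ∃ C : ℝ, 0 ≤ C ∧ ∃ N : ℕ, 2 ≤ N ∧ ∀ n, N ≤ n →
      |T α β x (i + i) n - (-4 / (1 - x^2)) ^ i * T α β x 0 n| ≤ C / (n * √n) := by
  have p4 : 0 < 1 - x^2 := by nlinarith [hx.1, hx.2]
  induction i with
  | zero => refine ⟨0, le_rfl, 2, le_rfl, fun n hn => by simp⟩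
  | succ i ih =>
    obtain ⟨C, hC, N, hN, h⟩ := ih
    obtain ⟨C0, hC0, N0, hN0, h0⟩ := Tj_bound hα hβ hx (i+i)
    obtain ⟨C1, hC1, N1, hN1, h1⟩ := Tj_bound hα hβ hx (i+i+1)
    set s := α + β with hs
    set w := 1 - x^2 with hw
    set A := |4 * (2 * ((i + i : ℕ):ℝ) + 2 + s)| / w with hA
    set B := |2 * ((β - α) - (α + β + 2 * ((i + i : ℕ):ℝ) + 2) * x)| / w with hB
    refine ⟨4 / w * C + A * C0 + B * C1, by positivity, N + N0 + N1 + (i + i) + 2, by omega,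
      fun n hn => ?_⟩
    have b := TB (α := α) (β := β) (i+i) n (by omega) hx
    have h := h n (by omega)
    have h0 := h0 n (by omega)
    have h1 := h1 n (by omega)
    rw [show i + 1 + (i + 1) = i + i + 2 by ring]
    have hn2 : (2:ℝ) ≤ n := by exact_mod_cast (show 2 ≤ n by omega)
    have hn0 : (0:ℝ) < n := by linarith
    set j : ℝ := ((i + i : ℕ):ℝ) with hj
    have hj0 : 0 ≤ j := by positivity
    have hs2 : -2 < s := by linarith
    set D := (n:ℝ) + j + 2 + s with hD
    have hDn : n ≤ D := by linarith
    have hD0 : 0 < D := by linarith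
    have key : T α β x (i+i+2) n - (-4 / w) ^ (i+1) * T α β x 0 n =
        (-4 / w) * (T α β x (i+i) n - (-4 / w) ^ i * T α β x 0 n)
        + 4 * (2 * j + 2 + s) / w * (T α β x (i+i) n / D)
        + (- (2 * ((β - α) - (α + β + 2 * j + 2) * x) / w)) * (T α β x (i+i+1) n / D) := by
      have : T α β x (i+i+2) n = - (4 * ((n:ℝ) - j) * T α β x (i+i) n +
        2 * ((β - α) - (α + β + 2 * j + 2) * x) * T α β x (i+i+1) n) / (D * w) := by
        rw [b, ← hw]; field_simp
      rw [this, pow_succ]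
      field_simp
      rw [hD]
      ring
    rw [key]
    refine (abs_add_three _ _ _).trans ?_
    have d : ∀ y c : ℝ, |y| ≤ c / √n → |y / D| ≤ c / (n * √n) := by
      intro y c hy
      rw [abs_div, abs_of_pos hD0]
      calc |y| / D ≤ |y| / n := by gcongr
        _ ≤ (c / √n) / n := by gcongr
        _ = _ := by rw [div_div, mul_comm]
    have d0 := d _ _ h0
    have d1 := d _ _ h1
    rw [abs_mul, abs_mul, abs_mul, abs_neg, abs_div (-4) w,
      abs_div (4 * (2 * j + 2 + s)) w, abs_div (2 * (β - α - (α + β + 2 * j + 2) * x)) w, abs_of_pos p4]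
    rw [← hA, ← hB, show |(-4:ℝ)| = 4 by norm_num]
    have a1 := mul_le_mul_of_nonneg_left h (by positivity : 0 ≤ 4 / w)
    have a2 := mul_le_mul_of_nonneg_left d0 (by positivity : 0 ≤ A)
    have a3 := mul_le_mul_of_nonneg_left d1 (by positivity : 0 ≤ B)
    calc _ ≤ 4 / w * (C / (n * √n)) + A * (C0 / (n * √n)) + B * (C1 / (n * √n)) := by linarith
      _ = _ := by ring

end JC

theorem jacobi_cancellation (α β : ℝ) (hα : -1 < α) (hβ : -1 < β)
    (lam : ℕ) (hlam : 0 < lam) (hev : Even lam) (a : ℝ) (ha : a ∈ Set.Ioo (-1 : ℝ) 1) :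
    ∃ C : ℝ, 0 < C ∧ ∃ N : ℕ, ∀ n : ℕ, N ≤ n →
      |jacobiP (α + lam) (β + lam) (n - lam) a * jacobiP α β (n + 1) a -
        jacobiP (α + lam) (β + lam) (n + 1 - lam) a * jacobiP α β n a| ≤
      C * (n : ℝ) ^ (-(2 : ℝ)) := by
  obtain ⟨i, rfl⟩ := hev
  obtain ⟨C, hC, N, hN, h⟩ := JC.T_even hα hβ ha i
  obtain ⟨C0, hC0, N0, hN0, h0⟩ := JC.T0_bound hα hβ ha
  refine ⟨2 * C * C0 + 1, by positivity, N + N0, fun n hn => ?_⟩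
  have e0 : ∀ m, jacobiP α β m a = JC.T α β a 0 m := fun m => by unfold JC.T; simp
  have e1 : ∀ m, jacobiP (α + ((i + i : ℕ):ℝ)) (β + ((i + i : ℕ):ℝ)) (m - (i + i)) a
    = JC.T α β a (i + i) m := fun m => rfl
  rw [e0, e0, e1, e1]
  have x1 := h n (by omega)
  have x2 := h (n+1) (by omega)
  have y1 := h0 n (by omega)
  have y2 := h0 (n+1) (by omega)
  set κ := (-4 / (1 - a^2)) ^ i
  have hn2 : (2:ℝ) ≤ n := by exact_mod_cast (show 2 ≤ n by omega)
  have hn0 : (0:ℝ) < n := by linarith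
  have sq : √(n:ℝ) ≤ √((n+1:ℕ):ℝ) := Real.sqrt_le_sqrt (by push_cast; linarith)
  have s0 : 0 < √(n:ℝ) := Real.sqrt_pos.2 hn0
  have x2' : |JC.T α β a (i + i) (n+1) - κ * JC.T α β a 0 (n+1)| ≤ C / (n * √n) := by
    refine x2.trans ?_
    gcongr
    push_cast; linarith
  have y2' : |JC.T α β a 0 (n+1)| ≤ C0 / √n := by
    refine y2.trans ?_
    gcongr
  have key : JC.T α β a (i + i) n * JC.T α β a 0 (n + 1) -
      JC.T α β a (i + i) (n + 1) * JC.T α β a 0 n =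
      (JC.T α β a (i + i) n - κ * JC.T α β a 0 n) * JC.T α β a 0 (n+1) -
      (JC.T α β a (i + i) (n+1) - κ * JC.T α β a 0 (n+1)) * JC.T α β a 0 n := by ring
  rw [key]
  refine (abs_sub _ _).trans ?_
  rw [abs_mul, abs_mul]
  have r : (n:ℝ) ^ (-(2:ℝ)) = 1 / n^2 := by
    rw [Real.rpow_neg hn0.le]; norm_cast; rw [one_div]
  rw [r]
  calc _ ≤ (C / (n * √n)) * (C0 / √n) + (C / (n * √n)) * (C0 / √n) := by gcongr
    _ = 2 * C * C0 * (1 / n^2) := by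
      have : √(n:ℝ) * √n = n := Real.mul_self_sqrt hn0.le
      rw [div_mul_div_comm, mul_assoc (n:ℝ), this]; ring
    _ ≤ _ := by gcongr; linarith
end
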